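/- For all k, k' ≥ 1, all n, n' ∈ ℕ₀ and all 1 ≤ l ≤ 2n+1, 1 ≤ l' ≤ 2n'+1, the gradients of the generalized ball polynomials are mutually orthogonal in L²(B³): ∫_{B³} ∇B_{k,l}^{−1,n}(x) · ∇B_{k',l'}^{−1,n'}(x) dx = (2n+4k+1) δ_{kk'} δ_{nn'} δ_{ll'}, where δ denotes the Kronecker delta. In particular the stiffness matrix of the spectral-Galerkin scheme in this basis is strictly diagonal. -/

import Mathlib

open MeasureTheory Real
open scoped RealInnerProductSpace

noncomputable section

/-- Jacobi polynomial `P_n^{α,β}(t)`. -/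
def jacobiP (n : ℕ) (α β : ℝ) (t : ℝ) : ℝ :=
  (Real.Gamma (α + n + 1) / (n.factorial * Real.Gamma (α + β + n + 1))) *
    ∑ m ∈ Finset.range (n + 1), (n.choose m : ℝ) *
      (Real.Gamma (α + β + n + m + 1) / Real.Gamma (α + m + 1)) * ((t - 1) / 2) ^ m

/-- Normalization constant `C_{n,j}` of spherical harmonics. -/
def sphC (n j : ℕ) : ℝ :=
  (1 / 2 ^ j) * Real.sqrt ((2 * n + 1) * Real.Gamma ((n : ℝ) - j + 1) *
    Real.Gamma ((n : ℝ) + j + 1) / (2 * Real.pi * Real.Gamma ((n : ℝ) + 1) ^ 2))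

/-- Spherical harmonic `Y_l^n(θ, φ)`; for `l = 2j` the cosine type, for `l = 2j+1 ≥ 3`
the sine type (in both cases `j = l / 2` by natural division). -/
def sphY (n l : ℕ) (θ φ : ℝ) : ℝ :=
  if l = 1 then Real.sqrt ((2 * n + 1) / (4 * Real.pi)) * jacobiP n 0 0 (Real.cos θ)
  else if l % 2 = 0 then
    sphC n (l / 2) * Real.sin θ ^ (l / 2) * Real.cos ((l / 2 : ℕ) * φ) *
      jacobiP (n - l / 2) (l / 2 : ℕ) (l / 2 : ℕ) (Real.cos θ)
  else
    sphC n (l / 2) * Real.sin θ ^ (l / 2) * Real.sin ((l / 2 : ℕ) * φ) *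
      jacobiP (n - l / 2) (l / 2 : ℕ) (l / 2 : ℕ) (Real.cos θ)

abbrev E3 := EuclideanSpace ℝ (Fin 3)

/-- Pochhammer symbol `(a)_k = Γ(a+k)/Γ(a)`. -/
def poch (a : ℝ) (k : ℕ) : ℝ := Real.Gamma (a + k) / Real.Gamma a

/-- The solid spherical harmonic `‖x‖^n Y_l^n(x/‖x‖)`, written using the polar angles
`θ = arccos(x₃/‖x‖)` and the azimuthal angle `φ = arg(x₁ + i x₂)` of `x/‖x‖`. -/
def solidY (n l : ℕ) (x : E3) : ℝ :=
  ‖x‖ ^ n * sphY n l (Real.arccos (‖x‖⁻¹ * x 2)) (Complex.arg (x 0 + x 1 * Complex.I))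

/-- Ball polynomial `B_{k,l}^{α,n}(x)`. -/
def ballB (α : ℝ) (k n l : ℕ) (x : E3) : ℝ :=
  (poch ((n : ℝ) + k + 3 / 2) k / poch ((n : ℝ) + k + α + 3 / 2) k) *
    jacobiP k α ((n : ℝ) + 1 / 2) (2 * ‖x‖ ^ 2 - 1) * solidY n l x

/-- Normalization constant `h_k^{α,n}`. -/
def hNorm (α : ℝ) (k n : ℕ) : ℝ :=
  Real.Gamma ((k : ℝ) + α + 1) * Real.Gamma ((n : ℝ) + 2 * k + 3 / 2) *
      poch ((n : ℝ) + k + 3 / 2) k /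
    (2 * Real.Gamma ((k : ℝ) + 1) * Real.Gamma ((n : ℝ) + 2 * k + α + 5 / 2) *
      poch ((n : ℝ) + k + α + 3 / 2) k)

/-- Generalized ball polynomial `B_{k,l}^{-1,n}`. -/
def genBallB (k n l : ℕ) (x : E3) : ℝ :=
  if k = 0 then ballB 0 0 n l x else ballB 0 k n l x - ballB 0 (k - 1) n l x

end

open Polynomial in
/-- The Jacobi polynomial `P_m^{α,β}` in the variable `v = (t - 1) / 2`. -/
noncomputable def jacobiPoly (m : ℕ) (α β : ℝ) : ℝ[X] :=
  ∑ i ∈ Finset.range (m + 1), monomial i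
    ((Real.Gamma (α + m + 1) / (m.factorial * Real.Gamma (α + β + m + 1))) *
      ((m.choose i : ℝ) * (Real.Gamma (α + β + m + i + 1) / Real.Gamma (α + i + 1))))

section OneVariable
open Polynomial

theorem jacobiP_eq_eval (m : ℕ) (α β t : ℝ) :
    jacobiP m α β t = (jacobiPoly m α β).eval ((t - 1) / 2) := by
  simp only [jacobiP, jacobiPoly, eval_finsetSum, eval_monomial, Finset.mul_sum]
  exact Finset.sum_congr rfl fun i _ => by ring

theorem coeff_jacobiPoly (m : ℕ) (α β : ℝ) (i : ℕ) :
    (jacobiPoly m α β).coeff i =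
      (Real.Gamma (α + m + 1) / (m.factorial * Real.Gamma (α + β + m + 1))) *
      ((m.choose i : ℝ) * (Real.Gamma (α + β + m + i + 1) / Real.Gamma (α + i + 1))) := by
  simp only [jacobiPoly, finsetSum_coeff, coeff_monomial]
  rw [Finset.sum_ite_eq' (Finset.range (m + 1)) i]
  split_ifs with h
  · rfl
  · rw [Nat.choose_eq_zero_of_lt (by simpa using h)]; simp

theorem coeff_jacobiPoly_of_lt {m i : ℕ} (α β : ℝ) (h : m < i) :
    (jacobiPoly m α β).coeff i = 0 := by
  rw [coeff_jacobiPoly, Nat.choose_eq_zero_of_lt h]; simp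

theorem choose_succ_real (m i : ℕ) :
    (m.choose (i + 1) : ℝ) * (i + 1) = m.choose i * (m - i) := by
  rcases le_or_gt i m with h | h
  · rw [← Nat.cast_sub h]
    exact_mod_cast Nat.choose_succ_right_eq m i
  · rw [Nat.choose_eq_zero_of_lt h, Nat.choose_eq_zero_of_lt (by omega)]; simp

theorem coeff_jacobiPoly_succ (m : ℕ) {α β : ℝ} (hα : 0 ≤ α) (hβ : 0 ≤ β) (i : ℕ) :
    (i + 1) * (i + α + 1) * (jacobiPoly m α β).coeff (i + 1) =
      (m - i) * (m + α + β + 1 + i) * (jacobiPoly m α β).coeff i := by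
  have h1 : α + i + 1 ≠ 0 := by positivity
  have h2 : α + β + m + i + 1 ≠ 0 := by positivity
  have e1 : Real.Gamma (α + (i + 1 : ℕ) + 1) = (α + i + 1) * Real.Gamma (α + i + 1) := by
    rw [← Real.Gamma_add_one h1]; push_cast; ring_nf
  have e2 : Real.Gamma (α + β + m + (i + 1 : ℕ) + 1) =
      (α + β + m + i + 1) * Real.Gamma (α + β + m + i + 1) := by
    rw [← Real.Gamma_add_one h2]; push_cast; ring_nf
  have h3 : Real.Gamma (α + i + 1) ≠ 0 := (Real.Gamma_pos_of_pos (by positivity)).ne'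
  have hc := choose_succ_real m i
  rw [coeff_jacobiPoly, coeff_jacobiPoly, e1, e2]
  set K := (Real.Gamma (α + m + 1) / (m.factorial * Real.Gamma (α + β + m + 1)))
  set G := Real.Gamma (α + β + m + i + 1)
  set G' := Real.Gamma (α + i + 1)
  field_simp
  linear_combination (K * G * (α + β + m + i + 1) * (α + i + 1)) * hc

theorem coeff_X_mul_derivative (p : ℝ[X]) (i : ℕ) :
    (X * derivative p).coeff i = i * p.coeff i := by
  cases i with
  | zero => simp
  | succ i => rw [coeff_X_mul, coeff_derivative]; push_cast; ring

/-- Jacobi's differential equation in the variable `v = (t - 1) / 2`. -/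
theorem jacobiPoly_ode (m : ℕ) {α β : ℝ} (hα : 0 ≤ α) (hβ : 0 ≤ β) :
    X * (1 + X) * derivative (derivative (jacobiPoly m α β)) +
      (C (α + 1) + C (α + β + 2) * X) * derivative (jacobiPoly m α β) =
      C (m * (m + α + β + 1)) * jacobiPoly m α β := by
  set p := jacobiPoly m α β with hp
  have key : X * (1 + X) * derivative (derivative p) +
      (C (α + 1) + C (α + β + 2) * X) * derivative p =
      X * derivative (derivative p) + (X * derivative (X * derivative p) - X * derivative p) +
      C (α + 1) * derivative p + C (α + β + 2) * (X * derivative p) := by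
    simp only [derivative_mul, derivative_X]; ring
  rw [key]
  ext i
  simp only [coeff_add, coeff_sub, coeff_C_mul, coeff_X_mul_derivative, coeff_derivative]
  have := coeff_jacobiPoly_succ m hα hβ i
  rw [← hp] at this
  linear_combination this

theorem coeff_zero_jacobiPoly (m : ℕ) {β : ℝ} (hβ : 0 ≤ β) :
    (jacobiPoly m 0 β).coeff 0 = 1 := by
  have : Real.Gamma (β + m + 1) ≠ 0 := (Real.Gamma_pos_of_pos (by positivity)).ne'
  rw [coeff_jacobiPoly]
  simp [Real.Gamma_nat_eq_factorial]
  field_simp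

theorem derivative_jacobiPoly_succ (m j : ℕ) :
    derivative (jacobiPoly (m + 1) j j) =
      C ((m : ℝ) + 2 * j + 2) * jacobiPoly m (j + 1 : ℕ) (j + 1 : ℕ) := by
  ext i
  rw [coeff_derivative, coeff_C_mul, coeff_jacobiPoly, coeff_jacobiPoly]
  have e1 : Real.Gamma ((j : ℝ) + j + (m + 1 : ℕ) + (i + 1 : ℕ) + 1) =
      Real.Gamma (((j + 1 : ℕ) : ℝ) + (j + 1 : ℕ) + m + i + 1) := by
    push_cast; ring_nf
  have e2 : Real.Gamma ((j : ℝ) + (i + 1 : ℕ) + 1) = Real.Gamma (((j + 1 : ℕ) : ℝ) + i + 1) := by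
    push_cast; ring_nf
  have e3 : Real.Gamma ((j : ℝ) + (m + 1 : ℕ) + 1) = Real.Gamma (((j + 1 : ℕ) : ℝ) + m + 1) := by
    push_cast; ring_nf
  have e4 : Real.Gamma (((j + 1 : ℕ) : ℝ) + (j + 1 : ℕ) + m + 1) =
      ((m : ℝ) + 2 * j + 2) * Real.Gamma ((j : ℝ) + j + (m + 1 : ℕ) + 1) := by
    rw [show (m : ℝ) + 2 * j + 2 = (j : ℝ) + j + (m + 1 : ℕ) + 1 by push_cast; ring,
      ← Real.Gamma_add_one (by positivity)]
    push_cast; ring_nf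
  rw [e1, e2, e3, e4]
  have h1 : Real.Gamma ((j : ℝ) + j + (m + 1 : ℕ) + 1) ≠ 0 :=
    (Real.Gamma_pos_of_pos (by positivity)).ne'
  have h2 : Real.Gamma (((j + 1 : ℕ) : ℝ) + i + 1) ≠ 0 :=
    (Real.Gamma_pos_of_pos (by positivity)).ne'
  have hc : ((m + 1).choose (i + 1) : ℝ) * (i + 1) = (m + 1) * m.choose i := by
    exact_mod_cast (Nat.add_one_mul_choose_eq m i).symm
  have h3 : (m.factorial : ℝ) ≠ 0 := by positivity
  have h4 : (m : ℝ) + 2 * j + 2 ≠ 0 := by positivity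
  rw [Nat.factorial_succ, Nat.cast_mul]
  generalize Real.Gamma ((j : ℝ) + j + (m + 1 : ℕ) + 1) = G1 at *
  generalize Real.Gamma (((j + 1 : ℕ) : ℝ) + i + 1) = G2 at *
  generalize Real.Gamma (((j + 1 : ℕ) : ℝ) + (j + 1 : ℕ) + m + i + 1) = G3 at *
  generalize Real.Gamma (((j + 1 : ℕ) : ℝ) + m + 1) = G4 at *
  push_cast
  field_simp
  linear_combination (G3 * G4) * hc

/-- The derivative of `P_{k+1}^{0,β} - P_k^{0,β}` is a multiple of `P_k^{0,β+1}`. -/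
theorem derivative_jacobiPoly_sub (k : ℕ) {β : ℝ} (hβ : 0 ≤ β) :
    derivative (jacobiPoly (k + 1) 0 β - jacobiPoly k 0 β) =
      C (2 * k + β + 2) * jacobiPoly k 0 (β + 1) := by
  ext i
  rw [coeff_derivative, coeff_C_mul, coeff_sub, coeff_jacobiPoly, coeff_jacobiPoly,
    coeff_jacobiPoly]
  have p1 : β + k + 1 ≠ 0 := by positivity
  have p2 : β + k + i + 2 ≠ 0 := by positivity
  have e1 : Real.Gamma (0 + β + (k + 1 : ℕ) + 1) = (β + k + 1) * Real.Gamma (β + k + 1) := by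
    rw [← Real.Gamma_add_one p1]; push_cast; ring_nf
  have e1' : Real.Gamma (0 + (β + 1) + k + 1) = (β + k + 1) * Real.Gamma (β + k + 1) := by
    rw [← Real.Gamma_add_one p1]; ring_nf
  have e2 : Real.Gamma (0 + β + (k + 1 : ℕ) + (i + 1 : ℕ) + 1) =
      (β + k + i + 2) * Real.Gamma (β + k + i + 2) := by
    rw [← Real.Gamma_add_one p2]; push_cast; ring_nf
  have e3 : Real.Gamma (0 + β + k + (i + 1 : ℕ) + 1) = Real.Gamma (β + k + i + 2) := by
    push_cast; ring_nf
  have e4 : Real.Gamma (0 + (β + 1) + k + i + 1) = Real.Gamma (β + k + i + 2) := by ring_nf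
  have e5 : (0 : ℝ) + β + k + 1 = β + k + 1 := by ring
  have g1 : Real.Gamma (β + k + 1) ≠ 0 := (Real.Gamma_pos_of_pos (by positivity)).ne'
  have hf : ((i + 1).factorial : ℝ) = (i + 1) * i.factorial := by
    rw [Nat.factorial_succ]; push_cast; ring
  have hi : (i.factorial : ℝ) ≠ 0 := by positivity
  have hk : (k.factorial : ℝ) ≠ 0 := by positivity
  have hk' : ((k + 1).factorial : ℝ) ≠ 0 := by positivity
  have hc := choose_succ_real k i
  have hs : ((k + 1).choose (i + 1) : ℝ) = k.choose i + k.choose (i + 1) := by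
    exact_mod_cast Nat.choose_succ_succ k i
  rw [e1, e1', e2, e3, e4, e5, hs]
  simp only [zero_add, Real.Gamma_nat_eq_factorial]
  rw [hf]
  generalize Real.Gamma (β + k + i + 2) = G1 at *
  generalize Real.Gamma (β + k + 1) = G2 at *
  field_simp
  linear_combination G1 * hc

/-- Lower-degree orthogonality of `P_m^{0,γ}` for a functional that integrates by parts. -/
theorem jacobi_functional_mul_eq_zero (L : ℝ[X] →ₗ[ℝ] ℝ) {γ : ℝ} (hγ : 0 ≤ γ)
    (hL : ∀ g : ℝ[X], L ((1 + X) * derivative g + C (γ + 1) * g) = g.coeff 0)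
    (m : ℕ) (f : ℝ[X]) (hf : ∀ i, m ≤ i → f.coeff i = 0) :
    L (jacobiPoly m 0 γ * f) = 0 := by
  set p := jacobiPoly m 0 γ with hp
  have ode := jacobiPoly_ode m le_rfl hγ
  rw [← hp] at ode
  have mono : ∀ i, i < m → L (p * X ^ i) = 0 := by
    intro i
    induction i with
    | zero =>
      intro hm
      have h := hL (X * derivative p)
      have e : (1 + X) * derivative (X * derivative p) + C (γ + 1) * (X * derivative p) =
          (m * (m + γ + 1) : ℝ) • (p * X ^ 0) := by
        rw [smul_eq_C_mul]
        simp only [derivative_mul, derivative_X, map_add, map_mul, map_natCast, map_zero, map_one,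
          map_ofNat] at ode ⊢
        linear_combination ode
      rw [e, map_smul] at h
      simp only [smul_eq_mul, mul_coeff_zero, coeff_X_zero, zero_mul] at h
      have : (m * (m + γ + 1) : ℝ) ≠ 0 := by
        have : (0 : ℝ) < m := by exact_mod_cast hm
        positivity
      exact (mul_eq_zero.mp h).resolve_left this
    | succ i ih =>
      intro hm
      have h0 := ih (by omega)
      have h := hL (X * (derivative p * X ^ (i + 1) - p * derivative (X ^ (i + 1))))
      have e : (1 + X) * derivative (X * (derivative p * X ^ (i + 1) -
            p * derivative (X ^ (i + 1)))) +
          C (γ + 1) * (X * (derivative p * X ^ (i + 1) - p * derivative (X ^ (i + 1)))) =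
          (m * (m + γ + 1) - (i + 1) * (i + 1 + γ + 1) : ℝ) • (p * X ^ (i + 1)) -
          ((i + 1) ^ 2 : ℝ) • (p * X ^ i) := by
        rw [smul_eq_C_mul, smul_eq_C_mul]
        cases i with
        | zero =>
          simp only [derivative_mul, derivative_X, derivative_pow, map_sub,
            map_add, map_mul, map_natCast, map_zero, map_one, map_ofNat, map_pow] at ode ⊢
          simp
          linear_combination X * ode
        | succ i =>
          simp only [derivative_mul, derivative_X, derivative_pow, map_sub,
            map_add, map_mul, map_natCast, map_zero, map_one, map_ofNat, map_pow] at ode ⊢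
          simp
          linear_combination X ^ (i + 2) * ode
      rw [e, map_sub, map_smul, map_smul, h0] at h
      simp only [smul_eq_mul, mul_coeff_zero, coeff_X_zero, zero_mul, mul_zero, sub_zero] at h
      have : (m * (m + γ + 1) - (i + 1) * (i + 1 + γ + 1) : ℝ) ≠ 0 := by
        have h1 : ((i : ℝ) + 1) < m := by exact_mod_cast hm
        nlinarith
      exact (mul_eq_zero.mp h).resolve_left this
  rw [f.as_sum_range' (f.natDegree + 1) (by omega), Finset.mul_sum, map_sum]
  refine Finset.sum_eq_zero fun i _ => ?_
  rw [← C_mul_X_pow_eq_monomial, mul_left_comm, ← smul_eq_C_mul, map_smul]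
  rcases lt_or_ge i m with h | h
  · rw [mono i h, smul_zero]
  · rw [hf i h, zero_smul]

theorem jacobi_functional_mul_of_ne (L : ℝ[X] →ₗ[ℝ] ℝ) {γ : ℝ} (hγ : 0 ≤ γ)
    (hL : ∀ g : ℝ[X], L ((1 + X) * derivative g + C (γ + 1) * g) = g.coeff 0)
    {m m' : ℕ} (h : m ≠ m') :
    L (jacobiPoly m 0 γ * jacobiPoly m' 0 γ) = 0 := by
  rcases lt_or_gt_of_ne h with h | h
  · rw [mul_comm]
    exact jacobi_functional_mul_eq_zero L hγ hL _ _ fun i hi =>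
      coeff_jacobiPoly_of_lt _ _ (by omega)
  · exact jacobi_functional_mul_eq_zero L hγ hL _ _ fun i hi =>
      coeff_jacobiPoly_of_lt _ _ (by omega)

/-- The square norm of `P_m^{0,γ}` for a functional that integrates by parts. -/
theorem jacobi_functional_mul_self (L : ℝ[X] →ₗ[ℝ] ℝ) {γ : ℝ} (hγ : 0 ≤ γ)
    (hL : ∀ g : ℝ[X], L ((1 + X) * derivative g + C (γ + 1) * g) = g.coeff 0) (m : ℕ) :
    L (jacobiPoly m 0 γ * jacobiPoly m 0 γ) = 1 / (2 * m + γ + 1) := by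
  set p := jacobiPoly m 0 γ with hp
  have h := hL (p * p)
  have e : (1 + X) * derivative (p * p) + C (γ + 1) * (p * p) =
      (2 * m + γ + 1 : ℝ) • (p * p) +
        (2 : ℝ) • (p * (derivative p + X * derivative p - C (m : ℝ) * p)) := by
    rw [smul_eq_C_mul, smul_eq_C_mul]
    simp only [derivative_mul, map_add, map_mul, map_natCast, map_one, map_ofNat]
    ring
  have z : L (p * (derivative p + X * derivative p - C (m : ℝ) * p)) = 0 := by
    refine jacobi_functional_mul_eq_zero L hγ hL m _ fun i hi => ?_
    rw [coeff_sub, coeff_add, coeff_derivative, coeff_X_mul_derivative, coeff_C_mul, hp,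
      coeff_jacobiPoly_of_lt _ _ (show m < i + 1 by omega)]
    rcases hi.eq_or_lt with h | h
    · subst h; ring
    · rw [coeff_jacobiPoly_of_lt _ _ h]; ring
  rw [e, map_add, map_smul, map_smul, z, mul_coeff_zero, hp, coeff_zero_jacobiPoly m hγ,
    ← hp] at h
  have : (2 * m + γ + 1 : ℝ) ≠ 0 := by positivity
  simp only [smul_eq_mul] at h
  field_simp
  linarith

end OneVariable

/-- The integral of a polynomial over the unit sphere of `ℝ³`. -/
noncomputable def sphereInt (F : MvPolynomial (Fin 3) ℝ) : ℝ :=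
  ∫ ω : Metric.sphere (0 : E3) 1, MvPolynomial.eval ω.1.ofLp F ∂(volume : Measure E3).toSphere

section SphereIntegral
open MvPolynomial

theorem continuous_eval_ofLp (F : MvPolynomial (Fin 3) ℝ) :
    Continuous fun x : E3 => eval x.ofLp F :=
  (continuous_eval F).comp (PiLp.continuous_ofLp 2 _)

theorem integrable_sphere_eval (F : MvPolynomial (Fin 3) ℝ) :
    Integrable (fun ω : Metric.sphere (0 : E3) 1 => eval ω.1.ofLp F)
      (volume : Measure E3).toSphere :=
  ((continuous_eval_ofLp F).comp continuous_subtype_val).integrable_of_hasCompactSupport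
    (HasCompactSupport.of_compactSpace _)

theorem sphereInt_add (F G : MvPolynomial (Fin 3) ℝ) :
    sphereInt (F + G) = sphereInt F + sphereInt G := by
  simp only [sphereInt, map_add]
  exact integral_add (integrable_sphere_eval F) (integrable_sphere_eval G)

theorem sphereInt_smul (c : ℝ) (F : MvPolynomial (Fin 3) ℝ) :
    sphereInt (c • F) = c * sphereInt F := by
  simp only [sphereInt, smul_eval]
  exact integral_const_mul _ _

/-- `sphereInt` as a linear map. -/
noncomputable def sphereIntₗ : MvPolynomial (Fin 3) ℝ →ₗ[ℝ] ℝ where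
  toFun := sphereInt
  map_add' := sphereInt_add
  map_smul' := sphereInt_smul

theorem eval_smul_of_isHomogeneous {d : ℕ} {F : MvPolynomial (Fin 3) ℝ} (hF : F.IsHomogeneous d)
    (r : ℝ) (x : E3) : eval (r • x).ofLp F = r ^ d * eval x.ofLp F := by
  rw [WithLp.ofLp_smul, eval_eq, eval_eq, Finset.mul_sum]
  refine Finset.sum_congr rfl fun m hm => ?_
  have hd : ∑ i ∈ m.support, m i = d := by
    have := hF (mem_support_iff.mp hm)
    rw [Finsupp.weight_apply, Finsupp.sum] at this
    simpa using this
  simp only [Pi.smul_apply, smul_eq_mul, mul_pow, Finset.prod_mul_distrib,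
    Finset.prod_pow_eq_pow_sum, hd]
  ring

/-- Integration in polar coordinates of a radial weight times a homogeneous polynomial. -/
theorem integral_radial_mul_eval (g : ℝ → ℝ) {d : ℕ} {F : MvPolynomial (Fin 3) ℝ}
    (hF : F.IsHomogeneous d) :
    ∫ x : E3, g ‖x‖ * eval x.ofLp F =
      (∫ r in Set.Ioi (0 : ℝ), r ^ (d + 2) * g r) * sphereInt F := by
  have hdim : Module.finrank ℝ E3 - 1 = 2 := by simp
  calc
    ∫ x : E3, g ‖x‖ * eval x.ofLp F
      = ∫ x : ({(0)}ᶜ : Set E3), g ‖x.1‖ * eval x.1.ofLp F ∂((volume : Measure E3).comap (↑)) := by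
      rw [integral_subtype_comap (measurableSet_singleton _).compl
        fun x : E3 ↦ g ‖x‖ * eval x.ofLp F, restrict_compl_singleton]
    _ = ∫ p : Metric.sphere (0 : E3) 1 × Set.Ioi (0 : ℝ),
          (eval p.1.1.ofLp F) * (p.2.1 ^ d * g p.2)
          ∂(volume : Measure E3).toSphere.prod (.volumeIoiPow (Module.finrank ℝ E3 - 1)) := by
      rw [← (volume : Measure E3).measurePreserving_homeomorphUnitSphereProd.integral_comp
        (Homeomorph.measurableEmbedding _)]
      refine integral_congr_ae (.of_forall fun x => ?_)
      have hx : ‖x.1‖ ≠ 0 := norm_ne_zero_iff.mpr x.2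
      have : eval x.1.ofLp F = ‖x.1‖ ^ d * eval (‖x.1‖⁻¹ • x.1).ofLp F := by
        rw [← eval_smul_of_isHomogeneous hF, smul_inv_smul₀ hx]
      simp only [homeomorphUnitSphereProd_apply_fst_coe, homeomorphUnitSphereProd_apply_snd_coe]
      rw [this]; ring
    _ = sphereInt F * ∫ r : Set.Ioi (0 : ℝ), r.1 ^ d * g r
          ∂.volumeIoiPow (Module.finrank ℝ E3 - 1) :=
      integral_prod_mul (fun ω : Metric.sphere (0 : E3) 1 => eval ω.1.ofLp F)
        (fun r : Set.Ioi (0 : ℝ) => r.1 ^ d * g r)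
    _ = _ := by
      rw [hdim, mul_comm]
      congr 1
      simp only [Measure.volumeIoiPow, ENNReal.ofReal]
      rw [integral_withDensity_eq_integral_smul,
        integral_subtype_comap measurableSet_Ioi fun a : ℝ ↦ Real.toNNReal (a ^ 2) • (a ^ d * g a)]
      · refine setIntegral_congr_fun measurableSet_Ioi fun x hx ↦ ?_
        simp only [NNReal.smul_def, Real.coe_toNNReal _ (sq_nonneg x), smul_eq_mul]
        ring
      · exact (measurable_subtype_coe.pow_const _).real_toNNReal

theorem integral_closedBall_normSq_pow_mul_eval (i : ℕ) {d : ℕ} {F : MvPolynomial (Fin 3) ℝ}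
    (hF : F.IsHomogeneous d) :
    ∫ x in Metric.closedBall (0 : E3) 1, (‖x‖ ^ 2) ^ i * eval x.ofLp F =
      1 / (2 * i + d + 3) * sphereInt F := by
  have h := integral_radial_mul_eval ((Set.Iic (1 : ℝ)).indicator fun r => (r ^ 2) ^ i) hF
  have e1 : ∫ x in Metric.closedBall (0 : E3) 1, (‖x‖ ^ 2) ^ i * eval x.ofLp F =
      ∫ x : E3, ((Set.Iic (1 : ℝ)).indicator fun r => (r ^ 2) ^ i) ‖x‖ * eval x.ofLp F := by
    rw [← integral_indicator Metric.isClosed_closedBall.measurableSet]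
    refine integral_congr_ae (.of_forall fun x => ?_)
    by_cases hx : ‖x‖ ≤ 1 <;> simp [Set.indicator, hx]
  have e2 : ∫ r in Set.Ioi (0 : ℝ), r ^ (d + 2) *
      ((Set.Iic (1 : ℝ)).indicator fun r => (r ^ 2) ^ i) r = 1 / (2 * i + d + 3) := by
    have : ∀ r : ℝ, r ^ (d + 2) * ((Set.Iic (1 : ℝ)).indicator fun r => (r ^ 2) ^ i) r =
        (Set.Iic (1 : ℝ)).indicator (fun r => r ^ (d + 2 + 2 * i)) r := fun r => by
      by_cases hr : r ≤ 1 <;> simp [Set.indicator, hr, pow_add, pow_mul]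
    simp_rw [this]
    rw [setIntegral_indicator measurableSet_Iic, Set.Ioi_inter_Iic,
      ← intervalIntegral.integral_of_le zero_le_one, integral_pow]
    push_cast
    simp
    ring
  rw [e1, h, e2]

theorem hasGradientAt_eval (F : MvPolynomial (Fin 3) ℝ) (x : E3) :
    HasGradientAt (fun y : E3 => eval y.ofLp F)
      (WithLp.toLp 2 fun i => eval x.ofLp (pderiv i F)) x := by
  have key : HasFDerivAt (fun y : E3 => eval y.ofLp F)
      (∑ i, eval x.ofLp (pderiv i F) • (EuclideanSpace.proj i : E3 →L[ℝ] ℝ)) x := by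
    induction F using MvPolynomial.induction_on with
    | C a => simpa using hasFDerivAt_const a x
    | add p q hp hq =>
      simp only [map_add]
      refine (hp.fun_add hq).congr_fderiv ?_
      simp [add_smul, Finset.sum_add_distrib]
    | mul_X p j hp =>
      have hj : HasFDerivAt (fun y : E3 => y.ofLp j) (EuclideanSpace.proj j : E3 →L[ℝ] ℝ) x :=
        (EuclideanSpace.proj j : E3 →L[ℝ] ℝ).hasFDerivAt
      simp only [map_mul, eval_X]
      refine (hp.fun_mul hj).congr_fderiv ?_
      simp only [Derivation.leibniz, pderiv_X, smul_eq_mul, map_add, map_mul, eval_X, add_smul,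
        Finset.sum_add_distrib, Finset.smul_sum, smul_smul]
      congr 1
      rw [Finset.sum_eq_single j]
      · simp
      · intro i _ hi; simp [hi.symm]
      · simp
  rw [hasGradientAt_iff_hasFDerivAt]
  refine key.congr_fderiv ?_
  ext y
  simp [PiLp.inner_apply, mul_comm]

theorem integrable_exp_mul_norm_pow (d : ℕ) :
    Integrable fun x : E3 => exp (-‖x‖ ^ 2) * ‖x‖ ^ d := by
  refine (integrable_fun_norm_addHaar volume (f := fun r : ℝ => exp (-r ^ 2) * r ^ d)).mpr ?_
  have h := integrableOn_rpow_mul_exp_neg_mul_sq (b := 1) one_pos (s := (d + 2 : ℕ))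
    (by have := (Nat.cast_nonneg (α := ℝ) (d + 2)); linarith)
  refine h.congr_fun (fun r _ => ?_) measurableSet_Ioi
  simp only [rpow_natCast, finrank_euclideanSpace, Fintype.card_fin, smul_eq_mul, pow_add]
  ring_nf

theorem integrable_exp_mul_eval (F : MvPolynomial (Fin 3) ℝ) :
    Integrable fun x : E3 => exp (-‖x‖ ^ 2) * eval x.ofLp F := by
  rw [F.as_sum]
  simp only [map_sum, Finset.mul_sum]
  refine integrable_finsetSum _ fun m _ => ?_
  refine ((integrable_exp_mul_norm_pow (∑ i, m i)).const_mul |coeff m F|).mono'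
    ((Continuous.mul (by fun_prop) (continuous_eval_ofLp _)).aestronglyMeasurable)
    (.of_forall fun x => ?_)
  rw [eval_monomial, Finsupp.prod_fintype _ _ (by simp), norm_mul, norm_mul, Real.norm_eq_abs,
    Real.norm_eq_abs, abs_exp, norm_prod, ← Finset.prod_pow_eq_pow_sum, mul_left_comm]
  gcongr with i
  rw [norm_pow]
  gcongr
  exact PiLp.norm_apply_le x i

theorem integral_exp_mul_pderiv (F : MvPolynomial (Fin 3) ℝ) (i : Fin 3) :
    ∫ x : E3, exp (-‖x‖ ^ 2) * eval x.ofLp (pderiv i F) =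
      2 * ∫ x : E3, exp (-‖x‖ ^ 2) * eval x.ofLp (X i * F) := by
  set v : E3 := EuclideanSpace.single i 1 with hv
  have hF (x : E3) : fderiv ℝ (fun y : E3 => eval y.ofLp F) x v = eval x.ofLp (pderiv i F) := by
    rw [(hasGradientAt_iff_hasFDerivAt.mp (hasGradientAt_eval F x)).fderiv]
    simp [hv, EuclideanSpace.inner_single_right]
  have hE (x : E3) : HasFDerivAt (fun y : E3 => exp (-‖y‖ ^ 2))
      (exp (-‖x‖ ^ 2) • -((2 : ℕ) • (innerSL ℝ x : E3 →L[ℝ] ℝ))) x :=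
    ((hasStrictFDerivAt_norm_sq x).hasFDerivAt.fun_neg).exp
  have hE' (x : E3) : fderiv ℝ (fun y : E3 => exp (-‖y‖ ^ 2)) x v =
      -(2 * (exp (-‖x‖ ^ 2) * x.ofLp i)) := by
    rw [(hE x).fderiv]
    simp [hv, EuclideanSpace.inner_single_right]
    ring
  have hXF : (fun x : E3 => fderiv ℝ (fun y : E3 => exp (-‖y‖ ^ 2)) x v * eval x.ofLp F) =
      fun x : E3 => -2 * (exp (-‖x‖ ^ 2) * eval x.ofLp (X i * F)) := by
    funext x
    rw [hE', map_mul, eval_X]; ring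
  have h := integral_mul_fderiv_eq_neg_fderiv_mul_of_integrable (μ := (volume : Measure E3))
    (f := fun y : E3 => exp (-‖y‖ ^ 2)) (g := fun y : E3 => eval y.ofLp F) (v := v)
    (by rw [hXF]; exact (integrable_exp_mul_eval _).const_mul _)
    (by simp only [hF]; exact integrable_exp_mul_eval _)
    (integrable_exp_mul_eval F)
    (fun x _ => (hE x).differentiableAt)
    (fun x _ => (hasGradientAt_eval F x).differentiableAt)
  rw [hXF, integral_const_mul] at h
  simp only [hF] at h
  linarith

theorem integral_pow_mul_exp_neg_sq (m : ℕ) :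
    ∫ r in Set.Ioi (0 : ℝ), r ^ m * exp (-r ^ 2) = 1 / 2 * Real.Gamma ((m + 1) / 2) := by
  rw [← integral_rpow_mul_exp_neg_rpow (p := 2) (q := m) two_pos
    (by have := (Nat.cast_nonneg (α := ℝ) m); linarith)]
  simp

/-- Integration by parts on the sphere, for homogeneous polynomials. -/
theorem sphereInt_pderiv {d : ℕ} {G : MvPolynomial (Fin 3) ℝ} (hG : G.IsHomogeneous d)
    (i : Fin 3) : sphereInt (pderiv i G) = (d + 2) * sphereInt (X i * G) := by
  have hX : (X i * G).IsHomogeneous (d + 1) := by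
    rw [add_comm]; exact (isHomogeneous_X ℝ i).mul hG
  have h := integral_exp_mul_pderiv G i
  rw [integral_radial_mul_eval (fun r => exp (-r ^ 2)) hX,
    integral_radial_mul_eval (fun r => exp (-r ^ 2)) hG.pderiv, integral_pow_mul_exp_neg_sq,
    integral_pow_mul_exp_neg_sq] at h
  have hΓ : Real.Gamma (((d + 1 + 2 : ℕ) + 1) / 2) =
      ((d + 2) / 2) * Real.Gamma ((d + 2) / 2) := by
    rw [← Real.Gamma_add_one (by positivity)]; push_cast; ring_nf
  have hpos : Real.Gamma (((d : ℝ) + 2) / 2) ≠ 0 := (Real.Gamma_pos_of_pos (by positivity)).ne'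
  rw [hΓ] at h
  cases d with
  | zero =>
    have h0 : pderiv i G = 0 := by
      rw [← totalDegree_zero_iff_isHomogeneous, totalDegree_eq_zero_iff_eq_C] at hG
      rw [hG, pderiv_C]
    have hz : sphereInt (0 : MvPolynomial (Fin 3) ℝ) = 0 := by simp [sphereInt]
    rw [h0, hz] at h ⊢
    have : (2 : ℝ) * (1 / 2 * ((((0 : ℕ) : ℝ) + 2) / 2 * Gamma ((((0 : ℕ) : ℝ) + 2) / 2))) ≠ 0 := by
      positivity
    have h' : sphereInt (X i * G) = 0 := by
      rw [mul_zero, ← mul_assoc] at h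
      exact (mul_eq_zero.mp h.symm).resolve_left this
    rw [h', mul_zero]
  | succ d =>
    have e : ((d + 1 - 1 + 2 : ℕ) + 1 : ℝ) / 2 = ((d + 1 : ℕ) + 2) / 2 := by
      push_cast [Nat.add_sub_cancel]; ring
    rw [e] at h
    refine mul_left_cancel₀ hpos ?_
    linear_combination 2 * h

/-- The squared Euclidean norm as a polynomial. -/
noncomputable def normSqPoly : MvPolynomial (Fin 3) ℝ := X 0 ^ 2 + X 1 ^ 2 + X 2 ^ 2

theorem eval_normSqPoly (x : E3) : eval x.ofLp normSqPoly = ‖x‖ ^ 2 := by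
  simp [normSqPoly, EuclideanSpace.norm_sq_eq, Fin.sum_univ_three]

theorem isHomogeneous_normSqPoly : normSqPoly.IsHomogeneous 2 :=
  (((isHomogeneous_X_pow 0 2).add (isHomogeneous_X_pow 1 2)).add (isHomogeneous_X_pow 2 2))

theorem sphereInt_one : sphereInt 1 = 4 * π := by
  have : (volume : Measure E3).real (Metric.ball 0 1) = π * 4 / 3 := by
    rw [Measure.real, EuclideanSpace.volume_ball_fin_three]
    simp [ENNReal.toReal_ofReal (show 0 ≤ π * 4 / 3 by positivity)]
  simp only [sphereInt, map_one, integral_const, Measure.toSphere_real_apply_univ, this]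
  simp
  ring

end SphereIntegral

section Harmonic
open MvPolynomial

/-- The Laplacian of a polynomial. -/
noncomputable def polyLaplacian (F : MvPolynomial (Fin 3) ℝ) : MvPolynomial (Fin 3) ℝ :=
  ∑ i, pderiv i (pderiv i F)

/-- The inner product of the gradients of two polynomials. -/
noncomputable def gradDot (F G : MvPolynomial (Fin 3) ℝ) : MvPolynomial (Fin 3) ℝ :=
  ∑ i, pderiv i F * pderiv i G

theorem gradDot_comm (F G : MvPolynomial (Fin 3) ℝ) : gradDot F G = gradDot G F :=
  Finset.sum_congr rfl fun _ _ => mul_comm _ _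

theorem sphereInt_sum {ι : Type*} (s : Finset ι) (f : ι → MvPolynomial (Fin 3) ℝ) :
    sphereInt (∑ i ∈ s, f i) = ∑ i ∈ s, sphereInt (f i) :=
  map_sum sphereIntₗ f s

theorem sphereInt_sub (F G : MvPolynomial (Fin 3) ℝ) :
    sphereInt (F - G) = sphereInt F - sphereInt G :=
  map_sub sphereIntₗ F G

theorem sphereInt_C_mul (c : ℝ) (F : MvPolynomial (Fin 3) ℝ) :
    sphereInt (C c * F) = c * sphereInt F := by
  rw [C_mul', sphereInt_smul]

/-- Green's identity on the unit ball for homogeneous harmonic polynomials. -/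
theorem sphereInt_gradDot {n n' : ℕ} {H H' : MvPolynomial (Fin 3) ℝ} (hH : H.IsHomogeneous n)
    (hH' : H'.IsHomogeneous n') (hlap : polyLaplacian H' = 0) :
    sphereInt (gradDot H H') = (n + n' + 1) * n' * sphereInt (H * H') := by
  have h1 : gradDot H H' = ∑ i, pderiv i (H * pderiv i H') := by
    have : ∑ i, pderiv i (H * pderiv i H') = gradDot H H' + H * polyLaplacian H' := by
      simp only [gradDot, polyLaplacian, Finset.mul_sum, ← Finset.sum_add_distrib,
        Derivation.leibniz, smul_eq_mul]
      exact Finset.sum_congr rfl fun i _ => by ring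
    rw [this, hlap, mul_zero, add_zero]
  have h2 : ∑ i, X i * (H * pderiv i H') = C (n' : ℝ) * (H * H') := by
    have := hH'.sum_X_mul_pderiv
    rw [nsmul_eq_mul] at this
    rw [map_natCast, mul_left_comm, ← this, Finset.mul_sum]
    exact Finset.sum_congr rfl fun i _ => by ring
  rw [h1, sphereInt_sum,
    Finset.sum_congr rfl fun i _ => sphereInt_pderiv (hH.mul (hH'.pderiv (i := i))) i,
    ← Finset.mul_sum, ← sphereInt_sum, h2, sphereInt_C_mul]
  cases n' with
  | zero => simp
  | succ m => push_cast [Nat.add_sub_cancel]; ring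

theorem sphereInt_mul_of_ne {n n' : ℕ} {H H' : MvPolynomial (Fin 3) ℝ} (hH : H.IsHomogeneous n)
    (hH' : H'.IsHomogeneous n') (hlap : polyLaplacian H = 0) (hlap' : polyLaplacian H' = 0)
    (hn : n ≠ n') : sphereInt (H * H') = 0 := by
  have h1 := sphereInt_gradDot hH hH' hlap'
  have h2 := sphereInt_gradDot hH' hH hlap
  rw [gradDot_comm, mul_comm H'] at h2
  have h3 : ((n : ℝ) + n' + 1) * (n' - n) * sphereInt (H * H') = 0 := by linear_combination h2 - h1
  have h4 : (n' : ℝ) - n ≠ 0 := sub_ne_zero.mpr (by exact_mod_cast hn.symm)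
  have h5 : (n : ℝ) + n' + 1 ≠ 0 := by positivity
  exact (mul_eq_zero.mp h3).resolve_left (mul_ne_zero h5 h4)

/-- The infinitesimal rotation about the third axis. -/
noncomputable def rot (F : MvPolynomial (Fin 3) ℝ) : MvPolynomial (Fin 3) ℝ :=
  X 0 * pderiv 1 F - X 1 * pderiv 0 F

theorem rot_mul (F G : MvPolynomial (Fin 3) ℝ) : rot (F * G) = F * rot G + G * rot F := by
  simp only [rot, Derivation.leibniz, smul_eq_mul]; ring

theorem sphereInt_rot {d : ℕ} {F : MvPolynomial (Fin 3) ℝ} (hF : F.IsHomogeneous d) :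
    sphereInt (rot F) = 0 := by
  have h : rot F = pderiv 1 (X 0 * F) - pderiv 0 (X 1 * F) := by
    simp [rot, Derivation.leibniz]
  rw [h, sphereInt_sub, sphereInt_pderiv ((isHomogeneous_X ℝ 0).mul hF),
    sphereInt_pderiv ((isHomogeneous_X ℝ 1).mul hF), mul_left_comm, sub_self]

/-- The real and imaginary parts of `(x₀ + i x₁) ^ j` as polynomials. -/
noncomputable def azimuthal : ℕ → MvPolynomial (Fin 3) ℝ × MvPolynomial (Fin 3) ℝ
  | 0 => (1, 0)
  | j + 1 => (X 0 * (azimuthal j).1 - X 1 * (azimuthal j).2,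
      X 0 * (azimuthal j).2 + X 1 * (azimuthal j).1)

theorem isHomogeneous_azimuthal (j : ℕ) :
    (azimuthal j).1.IsHomogeneous j ∧ (azimuthal j).2.IsHomogeneous j := by
  induction j with
  | zero => exact ⟨isHomogeneous_one _ _, isHomogeneous_zero _ _ _⟩
  | succ j ih =>
    rw [add_comm]
    rw [add_comm 1 j, azimuthal, add_comm j 1]
    exact ⟨((isHomogeneous_X ℝ 0).mul ih.1).sub ((isHomogeneous_X ℝ 1).mul ih.2),
      ((isHomogeneous_X ℝ 0).mul ih.2).add ((isHomogeneous_X ℝ 1).mul ih.1)⟩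

theorem pderiv_azimuthal_succ (j : ℕ) :
    pderiv 0 (azimuthal (j + 1)).1 = (j + 1) * (azimuthal j).1 ∧
    pderiv 1 (azimuthal (j + 1)).1 = -((j + 1) * (azimuthal j).2) ∧
    pderiv 0 (azimuthal (j + 1)).2 = (j + 1) * (azimuthal j).2 ∧
    pderiv 1 (azimuthal (j + 1)).2 = (j + 1) * (azimuthal j).1 := by
  induction j with
  | zero => simp [azimuthal]
  | succ j ih =>
    obtain ⟨h1, h2, h3, h4⟩ := ih
    rw [azimuthal]
    simp only [map_sub, map_add, Derivation.leibniz, smul_eq_mul, h1, h2, h3, h4]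
    simp only [azimuthal, pderiv_X_self, pderiv_X_of_ne (show (0 : Fin 3) ≠ 1 by decide),
      pderiv_X_of_ne (show (1 : Fin 3) ≠ 0 by decide)]
    push_cast
    refine ⟨?_, ?_, ?_, ?_⟩ <;> ring

theorem pderiv_two_azimuthal (j : ℕ) :
    pderiv 2 (azimuthal j).1 = 0 ∧ pderiv 2 (azimuthal j).2 = 0 := by
  induction j with
  | zero => simp [azimuthal]
  | succ j ih => simp [azimuthal, ih.1, ih.2]

theorem polyLaplacian_azimuthal (j : ℕ) :
    polyLaplacian (azimuthal j).1 = 0 ∧ polyLaplacian (azimuthal j).2 = 0 := by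
  have h2 := pderiv_two_azimuthal j
  rcases j with _ | _ | j
  · simp [polyLaplacian, azimuthal]
  · simp [polyLaplacian, azimuthal, Fin.sum_univ_three]
  · have h := pderiv_azimuthal_succ (j + 1)
    have h' := pderiv_azimuthal_succ j
    have e : ((j : MvPolynomial (Fin 3) ℝ) + 1 + 1) = C ((j : ℝ) + 1 + 1) := by simp
    simp only [polyLaplacian, Fin.sum_univ_three, h, h2, Nat.cast_add, Nat.cast_one, e]
    simp [h']

theorem rot_azimuthal (j : ℕ) :
    rot (azimuthal j).1 = -(j * (azimuthal j).2) ∧ rot (azimuthal j).2 = j * (azimuthal j).1 := by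
  cases j with
  | zero => simp [rot, azimuthal]
  | succ j =>
    have h := pderiv_azimuthal_succ j
    simp only [rot, h]
    simp only [azimuthal]
    push_cast
    constructor <;> ring

theorem azimuthal_sq_add_sq (j : ℕ) :
    (azimuthal j).1 ^ 2 + (azimuthal j).2 ^ 2 = (normSqPoly - X 2 ^ 2) ^ j := by
  induction j with
  | zero => simp [azimuthal]
  | succ j ih =>
    rw [pow_succ (normSqPoly - X 2 ^ 2), ← ih, normSqPoly]
    simp only [azimuthal]
    ring

theorem sphereInt_neg (F : MvPolynomial (Fin 3) ℝ) : sphereInt (-F) = -sphereInt F :=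
  map_neg sphereIntₗ F

theorem sphereInt_natCast_mul (c : ℕ) (F : MvPolynomial (Fin 3) ℝ) :
    sphereInt (c * F) = c * sphereInt F := by
  rw [← sphereInt_C_mul, map_natCast]

theorem sphereInt_azimuthal_relations {d : ℕ} {R : MvPolynomial (Fin 3) ℝ}
    (hR : R.IsHomogeneous d) (hrot : rot R = 0) (j j' : ℕ) :
    j * sphereInt ((azimuthal j).2 * (azimuthal j').1 * R) +
      j' * sphereInt ((azimuthal j).1 * (azimuthal j').2 * R) = 0 ∧
    j * sphereInt ((azimuthal j).1 * (azimuthal j').2 * R) +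
      j' * sphereInt ((azimuthal j).2 * (azimuthal j').1 * R) = 0 ∧
    j' * sphereInt ((azimuthal j).1 * (azimuthal j').1 * R) =
      j * sphereInt ((azimuthal j).2 * (azimuthal j').2 * R) ∧
    j * sphereInt ((azimuthal j).1 * (azimuthal j').1 * R) =
      j' * sphereInt ((azimuthal j).2 * (azimuthal j').2 * R) := by
  obtain ⟨hA, hB⟩ := isHomogeneous_azimuthal j
  obtain ⟨hA', hB'⟩ := isHomogeneous_azimuthal j'
  have key {F G : MvPolynomial (Fin 3) ℝ} (hF : F.IsHomogeneous j) (hG : G.IsHomogeneous j') :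
      sphereInt (F * rot G * R) + sphereInt (rot F * G * R) = 0 := by
    rw [← sphereInt_add, ← sphereInt_rot ((hF.mul hG).mul hR), rot_mul, rot_mul, hrot]
    ring_nf
  have h1 := key hA hA'
  have h2 := key hB hB'
  have h3 := key hA hB'
  have h4 := key hB hA'
  simp only [rot_azimuthal, neg_mul, mul_neg, sphereInt_neg, mul_assoc,
    mul_left_comm _ (j' : MvPolynomial (Fin 3) ℝ),
    sphereInt_natCast_mul] at h1 h2 h3 h4 ⊢
  refine ⟨?_, ?_, ?_, ?_⟩ <;> linarith

theorem sphereInt_azimuthal_fst_snd {d : ℕ} {R : MvPolynomial (Fin 3) ℝ}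
    (hR : R.IsHomogeneous d) (hrot : rot R = 0) (j j' : ℕ) :
    sphereInt ((azimuthal j).1 * (azimuthal j').2 * R) = 0 := by
  obtain ⟨h1, h2, -, -⟩ := sphereInt_azimuthal_relations hR hrot j j'
  by_cases hj : j = j'
  · subst hj
    rw [mul_comm (azimuthal j).2] at h1
    rcases Nat.eq_zero_or_pos j with rfl | hpos
    · simp [azimuthal, sphereInt]
    · have : (0 : ℝ) < j := by exact_mod_cast hpos
      have h3 : (2 * (j : ℝ)) * sphereInt ((azimuthal j).1 * (azimuthal j).2 * R) = 0 := by
        linarith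
      exact (mul_eq_zero.mp h3).resolve_left (by positivity)
  · have h3 : ((j : ℝ) ^ 2 - (j' : ℝ) ^ 2) * sphereInt ((azimuthal j).1 * (azimuthal j').2 * R)
        = 0 := by linear_combination (j : ℝ) * h2 - (j' : ℝ) * h1
    refine (mul_eq_zero.mp h3).resolve_left ?_
    rw [← Ne, sub_ne_zero, Ne, sq_eq_sq₀ (by positivity) (by positivity)]
    exact_mod_cast hj

theorem sphereInt_azimuthal_of_ne {d : ℕ} {R : MvPolynomial (Fin 3) ℝ}
    (hR : R.IsHomogeneous d) (hrot : rot R = 0) {j j' : ℕ} (hj : j ≠ j') :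
    sphereInt ((azimuthal j).1 * (azimuthal j').1 * R) = 0 ∧
      sphereInt ((azimuthal j).2 * (azimuthal j').2 * R) = 0 := by
  obtain ⟨-, -, h1, h2⟩ := sphereInt_azimuthal_relations hR hrot j j'
  have hne : (j : ℝ) ^ 2 - (j' : ℝ) ^ 2 ≠ 0 := by
    rw [sub_ne_zero, Ne, sq_eq_sq₀ (by positivity) (by positivity)]
    exact_mod_cast hj
  constructor
  · refine (mul_eq_zero.mp (?_ : ((j : ℝ) ^ 2 - (j' : ℝ) ^ 2) * _ = 0)).resolve_left hne
    linear_combination (j : ℝ) * h2 - (j' : ℝ) * h1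
  · refine (mul_eq_zero.mp (?_ : ((j : ℝ) ^ 2 - (j' : ℝ) ^ 2) * _ = 0)).resolve_left hne
    linear_combination (j' : ℝ) * h2 - (j : ℝ) * h1

theorem sphereInt_azimuthal_self {d : ℕ} {R : MvPolynomial (Fin 3) ℝ}
    (hR : R.IsHomogeneous d) (hrot : rot R = 0) {j : ℕ} (hj : 0 < j) :
    sphereInt ((azimuthal j).1 * (azimuthal j).1 * R) =
        1 / 2 * sphereInt ((1 - X 2 ^ 2) ^ j * R) ∧
      sphereInt ((azimuthal j).2 * (azimuthal j).2 * R) =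
        1 / 2 * sphereInt ((1 - X 2 ^ 2) ^ j * R) := by
  obtain ⟨-, -, h1, -⟩ := sphereInt_azimuthal_relations hR hrot j j
  have h1 := mul_left_cancel₀ (by positivity) h1
  have h2 : sphereInt ((azimuthal j).1 * (azimuthal j).1 * R) +
      sphereInt ((azimuthal j).2 * (azimuthal j).2 * R) =
        sphereInt ((1 - X 2 ^ 2) ^ j * R) := by
    rw [← sphereInt_add, ← add_mul, ← sq, ← sq, azimuthal_sq_add_sq]
    unfold sphereInt
    congr 1
    funext ω
    simp only [map_mul, map_pow, map_sub, eval_normSqPoly, norm_eq_of_mem_sphere, map_one]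
    norm_num
  constructor <;> linarith

end Harmonic

section Gegenbauer
open Polynomial

/-- The Jacobi polynomial `P_m^{j,j}` as a polynomial in its standard variable. -/
noncomputable def gegenbauer (m j : ℕ) : ℝ[X] := (jacobiPoly m j j).comp (C (1 / 2) * (X - 1))

theorem eval_gegenbauer (m j : ℕ) (t : ℝ) : (gegenbauer m j).eval t = jacobiP m j j t := by
  rw [jacobiP_eq_eval, gegenbauer, eval_comp]
  congr 1
  simp; ring

theorem derivative_gegenbauer_succ (m j : ℕ) :
    derivative (gegenbauer (m + 1) j) = C ((m + 2 * j + 2 : ℝ) / 2) * gegenbauer m (j + 1) := by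
  rw [gegenbauer, gegenbauer, derivative_comp, derivative_jacobiPoly_succ, mul_comp, C_comp,
    ← mul_assoc]
  congr 1
  simp only [derivative_mul, derivative_C, derivative_sub, derivative_X, derivative_one, zero_mul,
    zero_add, sub_zero, mul_one, ← C_mul]
  congr 1; ring

theorem gegenbauer_ode (m j : ℕ) :
    (X ^ 2 - 1) * derivative (derivative (gegenbauer m j)) +
      C (2 * (j + 1) : ℝ) * X * derivative (gegenbauer m j) =
      C ((m : ℝ) * (m + 2 * j + 1)) * gegenbauer m j := by
  have h := congrArg (fun p : ℝ[X] => p.comp (C (1 / 2) * (X - 1)))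
    (jacobiPoly_ode m j.cast_nonneg j.cast_nonneg)
  have hd (p : ℝ[X]) : (derivative p).comp (C (1 / 2) * (X - 1)) =
      C 2 * derivative (p.comp (C (1 / 2) * (X - 1))) := by
    rw [derivative_comp]
    simp only [derivative_mul, derivative_C, derivative_sub, derivative_X, derivative_one, zero_mul,
      zero_add, sub_zero, mul_one]
    rw [← mul_assoc, ← C_mul]; norm_num
  simp only [add_comp, mul_comp, C_comp, X_comp, one_comp, hd, derivative_mul, derivative_C,
    zero_mul, zero_add] at h
  rw [gegenbauer]
  generalize (jacobiPoly m (j : ℝ) j).comp (C (1 / 2) * (X - 1)) = u at h ⊢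
  refine Polynomial.funext fun t => ?_
  have h' := congrArg (eval t) h
  simp only [eval_add, eval_mul, eval_sub, eval_pow, eval_X, eval_C, eval_one] at h' ⊢
  linear_combination h'

theorem coeff_gegenbauer_recurrence (m j i : ℕ) :
    ((i : ℝ) + 2) * (i + 1) * (gegenbauer m j).coeff (i + 2) +
      ((m : ℝ) - i) * (m + i + 2 * j + 1) * (gegenbauer m j).coeff i = 0 := by
  have h := congrArg (fun p : ℝ[X] => p.coeff i) (gegenbauer_ode m j)
  simp only [sub_mul, one_mul, coeff_add, coeff_sub, mul_assoc, coeff_C_mul,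
    coeff_X_mul_derivative, sq] at h
  have h2 : (X * (X * derivative (derivative (gegenbauer m j)))).coeff i =
      (i : ℝ) * (i - 1) * (gegenbauer m j).coeff i := by
    rcases i with _ | _ | i
    · simp
    · simp
    · simp only [coeff_X_mul, coeff_derivative]; push_cast; ring
  have h3 : (derivative (derivative (gegenbauer m j))).coeff i =
      (i + 2) * (i + 1) * (gegenbauer m j).coeff (i + 2) := by
    simp only [coeff_derivative]; push_cast; ring
  rw [h2, h3] at h
  linear_combination -h

theorem natDegree_gegenbauer_le (m j : ℕ) : (gegenbauer m j).natDegree ≤ m := by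
  have h1 : (jacobiPoly m j j).natDegree ≤ m :=
    natDegree_le_iff_coeff_eq_zero.mpr fun i hi => coeff_jacobiPoly_of_lt _ _ hi
  have h2 : (C (1 / 2) * (X - 1) : ℝ[X]).natDegree ≤ 1 := by
    refine (natDegree_C_mul_le _ _).trans ?_
    rw [← C_1, natDegree_X_sub_C]
  exact natDegree_comp_le.trans ((Nat.mul_le_mul h1 h2).trans (by simp))

theorem coeff_gegenbauer_of_odd (j : ℕ) (q : ℕ) :
    ∀ i, (gegenbauer (i + (2 * q + 1)) j).coeff i = 0 := by
  suffices h : ∀ m, ∀ q i, i + (2 * q + 1) = m → (gegenbauer m j).coeff i = 0 from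
    fun i => h _ q i rfl
  intro m q
  induction q with
  | zero =>
    intro i hi
    have h := coeff_gegenbauer_recurrence m j i
    rw [coeff_eq_zero_of_natDegree_lt ((natDegree_gegenbauer_le m j).trans_lt (by omega))] at h
    have hm : (m : ℝ) = i + 1 := by exact_mod_cast hi.symm
    rw [hm, mul_zero, zero_add] at h
    exact (mul_eq_zero.mp h).resolve_left (by ring_nf; positivity)
  | succ q ih =>
    intro i hi
    have h := coeff_gegenbauer_recurrence m j i
    rw [ih (i + 2) (by omega)] at h
    have hm : (m : ℝ) = i + (2 * q + 3) := by rw [← hi]; push_cast; ring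
    rw [hm, mul_zero, zero_add] at h
    exact (mul_eq_zero.mp h).resolve_left (by ring_nf; positivity)

theorem sum_range_succ_of_odd_eq_zero {M : Type*} [AddCommMonoid M] (f : ℕ → M)
    (hf : ∀ q, f (2 * q + 1) = 0) (m : ℕ) :
    ∑ q ∈ Finset.range (m + 1), f q = ∑ p ∈ Finset.range (m / 2 + 1), f (2 * p) := by
  induction m using Nat.twoStepInduction with
  | zero => simp
  | one => simp [Finset.sum_range_succ, show f 1 = 0 from hf 0]
  | more m ih _ =>
    rw [Finset.sum_range_succ, Finset.sum_range_succ, ih, show (m + 2) / 2 = m / 2 + 1 by omega,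
      Finset.sum_range_succ _ (m / 2 + 1)]
    rcases Nat.even_or_odd' m with ⟨c, rfl | rfl⟩
    · rw [show 2 * c / 2 = c by omega, hf, add_zero, mul_add]
    · rw [show (2 * c + 1) / 2 = c by omega, show 2 * c + 1 + 1 + 1 = 2 * (c + 1) + 1 by ring,
        show 2 * c + 1 + 1 = 2 * (c + 1) by ring, hf, add_zero]

theorem sum_range_succ_telescope {M : Type*} [AddCommGroup M] (T U : ℕ → M) (P : ℕ)
    (h : ∀ p < P, T p + U (p + 1) = 0) :
    ∑ p ∈ Finset.range (P + 1), (T p + U p) = U 0 + T P := by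
  induction P with
  | zero => simp [add_comm]
  | succ P ih =>
    rw [Finset.sum_range_succ, ih fun p hp => h p (hp.trans P.lt_succ_self)]
    have := h P P.lt_succ_self
    rw [add_assoc, add_comm (T (P + 1)), ← add_assoc (T P), this, zero_add]

end Gegenbauer

section SolidHarmonic
open MvPolynomial

/-- The homogenization of `gegenbauer m j`, in the variables `x₂` and `‖x‖`. -/
noncomputable def zonal (m j : ℕ) : MvPolynomial (Fin 3) ℝ :=
  ∑ p ∈ Finset.range (m / 2 + 1),
    C ((gegenbauer m j).coeff (m - 2 * p)) * (X 2 ^ (m - 2 * p) * normSqPoly ^ p)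

theorem isHomogeneous_zonal (m j : ℕ) : (zonal m j).IsHomogeneous m := by
  refine IsHomogeneous.sum _ _ _ fun p hp => ?_
  have hp : m - 2 * p + 2 * p = m := by have := Finset.mem_range.mp hp; omega
  have := (isHomogeneous_X_pow (R := ℝ) (2 : Fin 3) (m - 2 * p)).mul
    (isHomogeneous_normSqPoly.pow p)
  rw [hp] at this
  exact this.C_mul _

theorem eval_zonal (m j : ℕ) {x : E3} (hx : x ≠ 0) :
    eval x.ofLp (zonal m j) = ‖x‖ ^ m * (gegenbauer m j).eval (‖x‖⁻¹ * x 2) := by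
  have hr : ‖x‖ ≠ 0 := norm_ne_zero_iff.mpr hx
  set f : ℕ → ℝ := fun q =>
    if q ≤ m then (gegenbauer m j).coeff (m - q) * (x 2 ^ (m - q) * ‖x‖ ^ q) else 0 with hf
  have hodd (q : ℕ) : f (2 * q + 1) = 0 := by
    simp only [hf]
    split_ifs with hq
    · have := coeff_gegenbauer_of_odd j q (m - (2 * q + 1))
      rw [Nat.sub_add_cancel hq] at this
      rw [this, zero_mul]
    · rfl
  have h1 : eval x.ofLp (zonal m j) = ∑ p ∈ Finset.range (m / 2 + 1), f (2 * p) := by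
    rw [zonal, map_sum]
    refine Finset.sum_congr rfl fun p hp => ?_
    have hp : 2 * p ≤ m := by have := Finset.mem_range.mp hp; omega
    simp only [hf, if_pos hp, map_mul, map_pow, eval_C, eval_X, eval_normSqPoly, pow_mul]
  rw [h1, ← sum_range_succ_of_odd_eq_zero f hodd,
    Polynomial.eval_eq_sum_range' (Nat.lt_succ_of_le (natDegree_gegenbauer_le m j)),
    Finset.mul_sum, ← Finset.sum_range_reflect]
  refine Finset.sum_congr rfl fun q hq => ?_
  have hq : q ≤ m := by have := Finset.mem_range.mp hq; omega
  rw [Nat.add_sub_cancel]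
  simp only [hf, if_pos (Nat.sub_le m q), Nat.sub_sub_self hq]
  rw [mul_pow, inv_pow, ← mul_assoc (‖x‖ ^ m), mul_comm (‖x‖ ^ m), mul_assoc, ← mul_assoc (‖x‖ ^ m),
    pow_sub₀ _ hr hq]
  ring

theorem gradDot_mul_left (F G K : MvPolynomial (Fin 3) ℝ) :
    gradDot (F * G) K = F * gradDot G K + G * gradDot F K := by
  simp only [gradDot, Derivation.leibniz, smul_eq_mul, Finset.mul_sum, ← Finset.sum_add_distrib]
  exact Finset.sum_congr rfl fun i _ => by ring

theorem pderiv_normSqPoly (i : Fin 3) : pderiv i normSqPoly = C 2 * X i := by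
  fin_cases i <;> simp [normSqPoly, Derivation.leibniz_pow,
    map_ofNat (C : ℝ →+* MvPolynomial (Fin 3) ℝ)]

theorem gradDot_aeval_normSqPoly (q : Polynomial ℝ) (K : MvPolynomial (Fin 3) ℝ) :
    gradDot (Polynomial.aeval normSqPoly q) K =
      Polynomial.aeval normSqPoly (Polynomial.derivative q) * gradDot normSqPoly K := by
  simp only [gradDot, Derivation.map_aeval, smul_eq_mul, Finset.mul_sum, mul_assoc]

theorem gradDot_normSqPoly_of_isHomogeneous {d : ℕ} {F : MvPolynomial (Fin 3) ℝ}
    (hF : F.IsHomogeneous d) : gradDot normSqPoly F = C (2 * d : ℝ) * F := by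
  have h := hF.sum_X_mul_pderiv
  simp only [gradDot, pderiv_normSqPoly, mul_assoc, ← Finset.mul_sum, h]
  simp [mul_assoc]

theorem polyLaplacian_mul (F G : MvPolynomial (Fin 3) ℝ) :
    polyLaplacian (F * G) = F * polyLaplacian G + 2 * gradDot F G + G * polyLaplacian F := by
  simp only [polyLaplacian, gradDot, Finset.mul_sum, ← Finset.sum_add_distrib]
  refine Finset.sum_congr rfl fun i _ => ?_
  simp only [Derivation.leibniz, smul_eq_mul, map_add]
  ring

theorem polyLaplacian_normSqPoly_pow (p : ℕ) :
    polyLaplacian (normSqPoly ^ p) = C (p * (4 * p + 2) : ℝ) * normSqPoly ^ (p - 1) := by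
  have hl : polyLaplacian normSqPoly = 6 := by
    simp [polyLaplacian, pderiv_normSqPoly]
    simp only [map_ofNat (C : ℝ →+* MvPolynomial (Fin 3) ℝ)]
    norm_num
  induction p with
  | zero => simp [polyLaplacian]
  | succ p ih =>
    have h := gradDot_normSqPoly_of_isHomogeneous (isHomogeneous_normSqPoly.pow p)
    rw [pow_succ', polyLaplacian_mul, h, ih, hl]
    rcases p with _ | p
    · simp [map_ofNat (C : ℝ →+* MvPolynomial (Fin 3) ℝ)]; norm_num
    · simp only [Nat.add_sub_cancel, pow_succ']
      simp [map_ofNat (C : ℝ →+* MvPolynomial (Fin 3) ℝ)]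
      ring

theorem polyLaplacian_mul_X_pow {A : MvPolynomial (Fin 3) ℝ} (hA : polyLaplacian A = 0)
    (hA2 : pderiv 2 A = 0) (i : ℕ) :
    polyLaplacian (A * X 2 ^ i) = C (i * (i - 1) : ℝ) * (A * X 2 ^ (i - 2)) := by
  have h1 : gradDot A (X 2 ^ i) = 0 := by
    simp [gradDot, Fin.sum_univ_three, Derivation.leibniz_pow, hA2]
  have h2 : polyLaplacian (X 2 ^ i) = C (i * (i - 1) : ℝ) * X 2 ^ (i - 2) := by
    rcases i with _ | _ | i
    · simp [polyLaplacian]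
    · simp [polyLaplacian, Fin.sum_univ_three]
    · simp [polyLaplacian, Fin.sum_univ_three, Derivation.leibniz_pow, Derivation.leibniz]
      ring
  rw [polyLaplacian_mul, h1, h2, hA]
  ring

theorem polyLaplacian_azimuthal_mul_zonal {A : MvPolynomial (Fin 3) ℝ} {j : ℕ}
    (hAj : A.IsHomogeneous j) (hA : polyLaplacian A = 0) (hA2 : pderiv 2 A = 0) (m : ℕ) :
    polyLaplacian (A * zonal m j) = 0 := by
  have hterm (c : ℝ) (i p : ℕ) : polyLaplacian (A * (C c * (X 2 ^ i * normSqPoly ^ p))) =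
      C (c * i * (i - 1)) * (A * X 2 ^ (i - 2) * normSqPoly ^ p) +
      C (c * p * (4 * i + 4 * j + 4 * p + 2)) * (A * X 2 ^ i * normSqPoly ^ (p - 1)) := by
    have e : A * (C c * (X 2 ^ i * normSqPoly ^ p)) =
        C c * (normSqPoly ^ p * (A * X 2 ^ i)) := by ring
    have hC (F : MvPolynomial (Fin 3) ℝ) : polyLaplacian (C c * F) = C c * polyLaplacian F := by
      simp [polyLaplacian, Finset.mul_sum]
    have hg : gradDot (normSqPoly ^ p) (A * X 2 ^ i) =
        C (2 * p * (j + i) : ℝ) * (normSqPoly ^ (p - 1) * (A * X 2 ^ i)) := by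
      have := gradDot_aeval_normSqPoly (Polynomial.X ^ p) (A * X 2 ^ i)
      rw [gradDot_normSqPoly_of_isHomogeneous (hAj.mul (isHomogeneous_X_pow 2 i))] at this
      simp [Polynomial.derivative_X_pow] at this
      rw [this]
      simp
      ring
    rw [e, hC, polyLaplacian_mul, hg, polyLaplacian_mul_X_pow hA hA2, polyLaplacian_normSqPoly_pow]
    simp [map_ofNat (C : ℝ →+* MvPolynomial (Fin 3) ℝ)]
    ring
  have hsum (s : Finset ℕ) (f : ℕ → MvPolynomial (Fin 3) ℝ) :
      polyLaplacian (∑ p ∈ s, f p) = ∑ p ∈ s, polyLaplacian (f p) := by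
    simp only [polyLaplacian, map_sum]
    exact Finset.sum_comm
  rw [zonal, Finset.mul_sum, hsum]
  simp only [hterm]
  rw [sum_range_succ_telescope]
  · have h : (((m - 2 * (m / 2) : ℕ) : ℝ)) * ((m - 2 * (m / 2) : ℕ) - 1) = 0 := by
      have : m - 2 * (m / 2) = 0 ∨ m - 2 * (m / 2) = 1 := by omega
      rcases this with h | h <;> simp [h]
    rw [mul_assoc ((gegenbauer m j).coeff (m - 2 * (m / 2))), h]
    simp
  · intro p hp
    have hi : m - 2 * p = m - 2 * (p + 1) + 2 := by omega
    have hm : (m : ℝ) = (m - 2 * (p + 1) : ℕ) + 2 * (p + 1) := by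
      have : m = m - 2 * (p + 1) + 2 * (p + 1) := by omega
      exact_mod_cast this
    have h := coeff_gegenbauer_recurrence m j (m - 2 * (p + 1))
    rw [hi, Nat.add_sub_cancel, Nat.add_sub_cancel, ← add_mul, ← C_add]
    have : (gegenbauer m j).coeff (m - 2 * (p + 1) + 2) * ((m - 2 * (p + 1) + 2 : ℕ) : ℝ) *
        ((m - 2 * (p + 1) + 2 : ℕ) - 1) + (gegenbauer m j).coeff (m - 2 * (p + 1)) * (p + 1 : ℕ) *
          (4 * (m - 2 * (p + 1) : ℕ) + 4 * j + 4 * (p + 1 : ℕ) + 2) = 0 := by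
      generalize (m - 2 * (p + 1)) = i at *
      push_cast
      rw [hm] at h
      linear_combination h
    rw [this, C_0, zero_mul]

theorem rot_zonal (m j : ℕ) : rot (zonal m j) = 0 := by
  simp [rot, zonal, Derivation.leibniz, Derivation.leibniz_pow, pderiv_normSqPoly,
    Finset.mul_sum, ← Finset.sum_sub_distrib]
  refine Finset.sum_eq_zero fun p _ => ?_
  ring

end SolidHarmonic

section Zonal
open Polynomial

/-- The integral over the unit sphere of a polynomial in the third coordinate. -/
noncomputable def zonalIntₗ : ℝ[X] →ₗ[ℝ] ℝ :=
  sphereIntₗ ∘ₗ (aeval (MvPolynomial.X 2 : MvPolynomial (Fin 3) ℝ)).toLinearMap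

theorem zonalIntₗ_apply (p : ℝ[X]) :
    zonalIntₗ p = sphereInt (aeval (MvPolynomial.X 2 : MvPolynomial (Fin 3) ℝ) p) := rfl

theorem succ_mul_sphereInt_X_two_pow (i : ℕ) :
    (i + 1) * sphereInt (MvPolynomial.X 2 ^ i) = 2 * π * (1 - (-1) ^ (i + 1)) := by
  induction i using Nat.twoStepInduction with
  | zero => rw [pow_zero, sphereInt_one]; norm_num; ring
  | one =>
    have h := sphereInt_pderiv (MvPolynomial.isHomogeneous_one (Fin 3) ℝ) 2
    have h0 : sphereInt 0 = 0 := map_zero sphereIntₗ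
    rw [MvPolynomial.pderiv_one, h0, mul_one] at h
    rw [pow_one]
    push_cast at h ⊢
    linear_combination -h
  | more i ih _ =>
    have h := sphereInt_pderiv (MvPolynomial.isHomogeneous_X_pow (R := ℝ) (2 : Fin 3) (i + 1)) 2
    have e : MvPolynomial.pderiv (2 : Fin 3) (MvPolynomial.X 2 ^ (i + 1) : MvPolynomial (Fin 3) ℝ) =
        MvPolynomial.C ((i : ℝ) + 1) * MvPolynomial.X 2 ^ i := by
      simp [Derivation.leibniz_pow]
    rw [e, sphereInt_C_mul, ih, ← pow_succ'] at h
    push_cast at h ⊢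
    rw [show (i : ℝ) + 2 + 1 = i + 1 + 2 by ring, ← h]
    ring

theorem zonalIntₗ_derivative (p : ℝ[X]) :
    zonalIntₗ (derivative p) = 2 * π * (p.eval 1 - p.eval (-1)) := by
  induction p using Polynomial.induction_on' with
  | add p q hp hq => rw [derivative_add, map_add, hp, hq, eval_add, eval_add]; ring
  | monomial i a =>
    rcases i with _ | i
    · simp
    · have h := succ_mul_sphereInt_X_two_pow i
      rw [derivative_monomial, zonalIntₗ_apply, aeval_monomial, Nat.add_sub_cancel,
        MvPolynomial.algebraMap_eq, sphereInt_C_mul, eval_monomial, eval_monomial]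
      push_cast
      rw [mul_assoc, h]
      ring

theorem zonalIntₗ_gegenbauer_zero (m : ℕ) :
    zonalIntₗ (gegenbauer m 0 * gegenbauer m 0) = 4 * π / (2 * m + 1) := by
  have h := jacobi_functional_mul_self (γ := 0)
    ((1 / (4 * π)) • (zonalIntₗ ∘ₗ (aeval (C (1 / 2) * (X - 1) : ℝ[X])).toLinearMap)) le_rfl
    (fun g => ?_) m
  · simp only [LinearMap.smul_apply, LinearMap.comp_apply, AlgHom.toLinearMap_apply, map_mul,
      smul_eq_mul, ← comp_eq_aeval] at h
    simp only [gegenbauer, Nat.cast_zero]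
    have hπ := pi_ne_zero
    field_simp at h ⊢
    linear_combination h
  · have e : aeval (C (1 / 2) * (X - 1) : ℝ[X]) ((1 + X) * derivative g + C ((0 : ℝ) + 1) * g) =
        (2 : ℝ) • derivative (((1 + X) * g).comp (C (1 / 2) * (X - 1))) := by
      rw [derivative_comp, ← comp_eq_aeval]
      simp only [derivative_mul, derivative_C, derivative_sub, derivative_add, derivative_X,
        derivative_one, zero_mul, zero_add, sub_zero, mul_one, one_mul, C_1]
      rw [← C_mul', ← mul_assoc, ← C_mul]
      norm_num [add_comm]
    simp only [LinearMap.smul_apply, LinearMap.comp_apply, AlgHom.toLinearMap_apply]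
    rw [e, map_smul, zonalIntₗ_derivative]
    have hπ := pi_ne_zero
    simp [coeff_zero_eq_eval_zero]
    norm_num
    field_simp
    norm_num

/-- The squared norms of the Gegenbauer polynomials. -/
theorem zonalIntₗ_gegenbauer_sq (m j : ℕ) :
    zonalIntₗ ((1 - X ^ 2) ^ j * (gegenbauer m j * gegenbauer m j)) =
      4 * π / (2 * (m + j) + 1) * (4 ^ j * ((m + j).factorial : ℝ) ^ 2 /
        (m.factorial * (m + 2 * j).factorial)) := by
  induction j generalizing m with
  | zero =>
    rw [pow_zero, one_mul, zonalIntₗ_gegenbauer_zero]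
    have : (m.factorial : ℝ) ≠ 0 := by positivity
    simp only [add_zero, mul_zero, pow_zero, one_mul, CharP.cast_eq_zero]
    field_simp
  | succ j ih =>
    set u := gegenbauer (m + 1) j with hu
    have hode := gegenbauer_ode (m + 1) j
    rw [← hu] at hode
    have hd : derivative ((1 - X ^ 2) ^ (j + 1) * derivative u * u) =
        (1 - X ^ 2) ^ (j + 1) * (derivative u * derivative u) -
          C (((m + 1 : ℕ) : ℝ) * ((m + 1 : ℕ) + 2 * j + 1)) * ((1 - X ^ 2) ^ j * (u * u)) := by
      rw [derivative_mul, derivative_mul, derivative_pow_succ]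
      simp only [derivative_sub, derivative_one, derivative_X_pow, map_mul] at hode ⊢
      simp at hode ⊢
      linear_combination -((1 - X ^ 2) ^ j * u) * hode
    have h0 := zonalIntₗ_derivative ((1 - X ^ 2) ^ (j + 1) * derivative u * u)
    have hd' := derivative_gegenbauer_succ m j
    rw [← hu] at hd'
    rw [hd, map_sub, C_mul', map_smul, hu, ih, ← hu, hd'] at h0
    have e : (1 - X ^ 2) ^ (j + 1) * (C ((m + 2 * j + 2 : ℝ) / 2) * gegenbauer m (j + 1) *
        (C ((m + 2 * j + 2 : ℝ) / 2) * gegenbauer m (j + 1))) =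
        (((m + 2 * j + 2 : ℝ) / 2) ^ 2) • ((1 - X ^ 2) ^ (j + 1) *
          (gegenbauer m (j + 1) * gegenbauer m (j + 1))) := by
      rw [← C_mul', C_pow]; ring
    rw [e, map_smul] at h0
    simp at h0
    generalize zonalIntₗ ((1 - X ^ 2) ^ (j + 1) *
          (gegenbauer m (j + 1) * gegenbauer m (j + 1))) = I at h0 ⊢
    have e1 : m + 1 + j = m + (j + 1) := by ring
    have e2 : m + 2 * (j + 1) = (m + 1 + 2 * j) + 1 := by ring
    rw [e1, Nat.factorial_succ m] at h0
    rw [e2, Nat.factorial_succ (m + 1 + 2 * j)]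
    have f1 : (m.factorial : ℝ) ≠ 0 := by positivity
    have f2 : ((m + 1 + 2 * j).factorial : ℝ) ≠ 0 := by positivity
    have f3 : (m : ℝ) + 2 * j + 2 ≠ 0 := by positivity
    have f4 : ((m : ℝ) + 2 * j + 2) ^ 2 / 4 ≠ 0 := by positivity
    refine mul_left_cancel₀ f4 ?_
    rw [div_pow] at h0
    norm_num at h0
    rw [sub_eq_zero] at h0
    rw [h0]
    push_cast
    field_simp
    ring

end Zonal

section SolidHarmonicBasis
open MvPolynomial

theorem sphereInt_congr {F G : MvPolynomial (Fin 3) ℝ}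
    (h : ∀ x : E3, ‖x‖ = 1 → eval x.ofLp F = eval x.ofLp G) : sphereInt F = sphereInt G := by
  unfold sphereInt
  congr 1
  funext ω
  exact h _ (norm_eq_of_mem_sphere ω)

theorem eval_aeval_X_two (p : Polynomial ℝ) (x : E3) :
    eval x.ofLp (Polynomial.aeval (X 2 : MvPolynomial (Fin 3) ℝ) p) = p.eval (x 2) := by
  induction p using Polynomial.induction_on' with
  | add p q hp hq => rw [map_add, map_add, hp, hq, Polynomial.eval_add]
  | monomial n a => simp [Polynomial.aeval_monomial]

theorem sphereInt_mul_zonal_sq (m j : ℕ) :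
    sphereInt ((1 - X 2 ^ 2) ^ j * (zonal m j * zonal m j)) =
      4 * π / (2 * (m + j) + 1) * (4 ^ j * ((m + j).factorial : ℝ) ^ 2 /
        (m.factorial * (m + 2 * j).factorial)) := by
  rw [← zonalIntₗ_gegenbauer_sq, zonalIntₗ_apply]
  refine sphereInt_congr fun x hx => ?_
  have hx0 : x ≠ 0 := by rintro rfl; simp at hx
  rw [eval_aeval_X_two]
  simp [eval_zonal _ _ hx0, hx]

/-- The normalization factor of the solid harmonics of order `j`. -/
noncomputable def harmonicNorm (n j : ℕ) : ℝ :=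
  if j = 0 then √((2 * n + 1) / (4 * π)) else sphC n j

/-- The solid harmonics of cosine type. -/
noncomputable def cosHarmonic (n j : ℕ) : MvPolynomial (Fin 3) ℝ :=
  C (harmonicNorm n j) * ((azimuthal j).1 * zonal (n - j) j)

/-- The solid harmonics of sine type. -/
noncomputable def sinHarmonic (n j : ℕ) : MvPolynomial (Fin 3) ℝ :=
  C (harmonicNorm n j) * ((azimuthal j).2 * zonal (n - j) j)

theorem polyLaplacian_C_mul (c : ℝ) (F : MvPolynomial (Fin 3) ℝ) :
    polyLaplacian (C c * F) = C c * polyLaplacian F := by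
  simp [polyLaplacian, Finset.mul_sum]

theorem cosHarmonic_spec {n j : ℕ} (hj : j ≤ n) :
    (cosHarmonic n j).IsHomogeneous n ∧ polyLaplacian (cosHarmonic n j) = 0 := by
  refine ⟨?_, ?_⟩
  · have := ((isHomogeneous_azimuthal j).1.mul (isHomogeneous_zonal (n - j) j)).C_mul
      (harmonicNorm n j)
    rwa [Nat.add_sub_cancel' hj] at this
  · rw [cosHarmonic, polyLaplacian_C_mul, polyLaplacian_azimuthal_mul_zonal
      (isHomogeneous_azimuthal j).1 (polyLaplacian_azimuthal j).1 (pderiv_two_azimuthal j).1,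
      mul_zero]

theorem sinHarmonic_spec {n j : ℕ} (hj : j ≤ n) :
    (sinHarmonic n j).IsHomogeneous n ∧ polyLaplacian (sinHarmonic n j) = 0 := by
  refine ⟨?_, ?_⟩
  · have := ((isHomogeneous_azimuthal j).2.mul (isHomogeneous_zonal (n - j) j)).C_mul
      (harmonicNorm n j)
    rwa [Nat.add_sub_cancel' hj] at this
  · rw [sinHarmonic, polyLaplacian_C_mul, polyLaplacian_azimuthal_mul_zonal
      (isHomogeneous_azimuthal j).2 (polyLaplacian_azimuthal j).2 (pderiv_two_azimuthal j).2,
      mul_zero]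

theorem rot_zonal_mul_zonal (m j m' j' : ℕ) : rot (zonal m j * zonal m' j') = 0 := by
  rw [rot_mul, rot_zonal, rot_zonal, mul_zero, mul_zero, add_zero]

theorem sphereInt_C_mul_mul_C_mul (c c' : ℝ) (A A' Z Z' : MvPolynomial (Fin 3) ℝ) :
    sphereInt (C c * (A * Z) * (C c' * (A' * Z'))) =
      c * c' * sphereInt (A * A' * (Z * Z')) := by
  rw [← sphereInt_C_mul, C_mul]
  congr 1
  ring

theorem harmonicNorm_sq {n j : ℕ} (hj : j ≤ n) (hpos : 0 < j) :
    harmonicNorm n j * harmonicNorm n j * (1 / 2 *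
      (4 * π / (2 * n + 1) * (4 ^ j * (n.factorial : ℝ) ^ 2 /
        ((n - j).factorial * (n + j).factorial)))) = 1 := by
  have h1 : Real.Gamma ((n : ℝ) - j + 1) = (n - j).factorial := by
    rw [← Nat.cast_sub hj, Real.Gamma_nat_eq_factorial]
  have h2 : Real.Gamma ((n : ℝ) + j + 1) = (n + j).factorial := by
    rw [← Nat.cast_add, Real.Gamma_nat_eq_factorial]
  have hπ := pi_pos
  have h3 : harmonicNorm n j * harmonicNorm n j = 1 / 2 ^ j * (1 / 2 ^ j) *
      ((2 * n + 1) * (n - j).factorial * (n + j).factorial / (2 * π * (n.factorial : ℝ) ^ 2)) := by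
    rw [harmonicNorm, if_neg hpos.ne', sphC, h1, h2, Real.Gamma_nat_eq_factorial, mul_mul_mul_comm,
      mul_self_sqrt (by positivity)]
  rw [h3]
  have f1 : ((n - j).factorial : ℝ) ≠ 0 := by positivity
  have f2 : ((n + j).factorial : ℝ) ≠ 0 := by positivity
  have f3 : (n.factorial : ℝ) ≠ 0 := by positivity
  have e : (4 : ℝ) ^ j = 2 ^ j * 2 ^ j := by rw [← mul_pow]; norm_num
  rw [e]
  field_simp
  norm_num

theorem sphereInt_cosHarmonic_mul_self {n j : ℕ} (hj : j ≤ n) :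
    sphereInt (cosHarmonic n j * cosHarmonic n j) = 1 := by
  have hN := sphereInt_mul_zonal_sq (n - j) j
  rw [Nat.sub_add_cancel hj, show n - j + 2 * j = n + j by omega,
    Nat.cast_sub hj, sub_add_cancel] at hN
  rw [cosHarmonic, sphereInt_C_mul_mul_C_mul]
  rcases Nat.eq_zero_or_pos j with rfl | hpos
  · have hπ := pi_pos
    have f3 : (n.factorial : ℝ) ≠ 0 := by positivity
    simp only [azimuthal, one_mul, pow_zero] at hN ⊢
    rw [hN, harmonicNorm, if_pos rfl, mul_self_sqrt (by positivity)]
    simp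
    field_simp
  · rw [(sphereInt_azimuthal_self ((isHomogeneous_zonal _ _).mul (isHomogeneous_zonal _ _))
      (rot_zonal_mul_zonal _ _ _ _) hpos).1, hN, harmonicNorm_sq hj hpos]

theorem sphereInt_sinHarmonic_mul_self {n j : ℕ} (hj : j ≤ n) (hpos : 0 < j) :
    sphereInt (sinHarmonic n j * sinHarmonic n j) = 1 := by
  have hN := sphereInt_mul_zonal_sq (n - j) j
  rw [Nat.sub_add_cancel hj, show n - j + 2 * j = n + j by omega,
    Nat.cast_sub hj, sub_add_cancel] at hN
  rw [sinHarmonic, sphereInt_C_mul_mul_C_mul,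
    (sphereInt_azimuthal_self ((isHomogeneous_zonal _ _).mul (isHomogeneous_zonal _ _))
      (rot_zonal_mul_zonal _ _ _ _) hpos).2, hN, harmonicNorm_sq hj hpos]

theorem sphereInt_cosHarmonic_mul_cosHarmonic (n : ℕ) {j j' : ℕ} (h : j ≠ j') :
    sphereInt (cosHarmonic n j * cosHarmonic n j') = 0 := by
  rw [cosHarmonic, cosHarmonic, sphereInt_C_mul_mul_C_mul,
    (sphereInt_azimuthal_of_ne ((isHomogeneous_zonal _ _).mul (isHomogeneous_zonal _ _))
      (rot_zonal_mul_zonal _ _ _ _) h).1, mul_zero]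

theorem sphereInt_sinHarmonic_mul_sinHarmonic (n : ℕ) {j j' : ℕ} (h : j ≠ j') :
    sphereInt (sinHarmonic n j * sinHarmonic n j') = 0 := by
  rw [sinHarmonic, sinHarmonic, sphereInt_C_mul_mul_C_mul,
    (sphereInt_azimuthal_of_ne ((isHomogeneous_zonal _ _).mul (isHomogeneous_zonal _ _))
      (rot_zonal_mul_zonal _ _ _ _) h).2, mul_zero]

theorem sphereInt_cosHarmonic_mul_sinHarmonic (n j j' : ℕ) :
    sphereInt (cosHarmonic n j * sinHarmonic n j') = 0 := by
  rw [cosHarmonic, sinHarmonic, sphereInt_C_mul_mul_C_mul,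
    sphereInt_azimuthal_fst_snd ((isHomogeneous_zonal _ _).mul (isHomogeneous_zonal _ _))
      (rot_zonal_mul_zonal _ _ _ _), mul_zero]

/-- The solid spherical harmonic `‖x‖ ^ n * Y_l^n (x / ‖x‖)` as a polynomial. -/
noncomputable def solidHarmonic (n l : ℕ) : MvPolynomial (Fin 3) ℝ :=
  if l = 1 then cosHarmonic n 0
  else if l % 2 = 0 then cosHarmonic n (l / 2) else sinHarmonic n (l / 2)

theorem solidHarmonic_spec {n l : ℕ} (hl : l ≤ 2 * n + 1) :
    (solidHarmonic n l).IsHomogeneous n ∧ polyLaplacian (solidHarmonic n l) = 0 := by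
  unfold solidHarmonic
  split_ifs
  · exact cosHarmonic_spec n.zero_le
  · exact cosHarmonic_spec (by omega)
  · exact sinHarmonic_spec (by omega)

theorem sphereInt_solidHarmonic_mul_self {n l : ℕ} (hl1 : 1 ≤ l) (hl2 : l ≤ 2 * n + 1) :
    sphereInt (solidHarmonic n l * solidHarmonic n l) = 1 := by
  unfold solidHarmonic
  split_ifs
  · exact sphereInt_cosHarmonic_mul_self n.zero_le
  · exact sphereInt_cosHarmonic_mul_self (by omega)
  · exact sphereInt_sinHarmonic_mul_self (by omega) (by omega)

theorem sphereInt_solidHarmonic_mul_of_ne (n : ℕ) {l l' : ℕ} (hl : 1 ≤ l) (hl' : 1 ≤ l')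
    (h : l ≠ l') : sphereInt (solidHarmonic n l * solidHarmonic n l') = 0 := by
  unfold solidHarmonic
  split_ifs
  · omega
  all_goals first
    | rw [sphereInt_cosHarmonic_mul_sinHarmonic]
    | rw [mul_comm, sphereInt_cosHarmonic_mul_sinHarmonic]
    | (rw [sphereInt_cosHarmonic_mul_cosHarmonic]; omega)
    | (rw [sphereInt_sinHarmonic_mul_sinHarmonic]; omega)

theorem eval_azimuthal (x : E3) (j : ℕ) :
    ((x 0 + x 1 * Complex.I : ℂ)) ^ j =
      eval x.ofLp (azimuthal j).1 + eval x.ofLp (azimuthal j).2 * Complex.I := by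
  induction j with
  | zero => simp [azimuthal]
  | succ j ih =>
    rw [pow_succ, ih]
    simp only [azimuthal, map_sub, map_add, map_mul, eval_X]
    push_cast
    linear_combination ((x 1 : ℂ) * eval x.ofLp (azimuthal j).2) * Complex.I_sq

theorem eval_azimuthal_eq_arg (x : E3) (j : ℕ) :
    eval x.ofLp (azimuthal j).1 = ‖(x 0 + x 1 * Complex.I : ℂ)‖ ^ j *
        cos (j * Complex.arg (x 0 + x 1 * Complex.I)) ∧
      eval x.ofLp (azimuthal j).2 = ‖(x 0 + x 1 * Complex.I : ℂ)‖ ^ j *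
        sin (j * Complex.arg (x 0 + x 1 * Complex.I)) := by
  have h := eval_azimuthal x j
  set w : ℂ := x 0 + x 1 * Complex.I
  have hw : w ^ j = ((‖w‖ ^ j : ℝ) : ℂ) *
      (Complex.cos ((j * w.arg : ℝ) : ℂ) + Complex.sin ((j * w.arg : ℝ) : ℂ) * Complex.I) := by
    conv_lhs => rw [← Complex.norm_mul_cos_add_sin_mul_I w, mul_pow, Complex.cos_add_sin_mul_I_pow]
    push_cast
    rfl
  rw [hw, ← Complex.ofReal_cos, ← Complex.ofReal_sin] at h
  constructor
  · simpa only [Complex.re_ofReal_mul, Complex.add_re, Complex.mul_I_re, Complex.ofReal_re,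
      Complex.ofReal_im, neg_zero, add_zero, zero_add] using (congrArg Complex.re h).symm
  · simpa only [Complex.im_ofReal_mul, Complex.add_im, Complex.mul_I_im, Complex.ofReal_re,
      Complex.ofReal_im, neg_zero, add_zero, zero_add] using (congrArg Complex.im h).symm

theorem norm_mul_sin_arccos (x : E3) :
    ‖x‖ * sin (arccos (‖x‖⁻¹ * x 2)) = ‖(x 0 + x 1 * Complex.I : ℂ)‖ := by
  have h1 : ‖(x 0 + x 1 * Complex.I : ℂ)‖ = √(x 0 ^ 2 + x 1 ^ 2) := Complex.norm_add_mul_I _ _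
  rw [sin_arccos, h1]
  rcases eq_or_ne x 0 with rfl | hx
  · simp
  have hr : 0 < ‖x‖ := norm_pos_iff.mpr hx
  nth_rewrite 1 [← sqrt_sq hr.le]
  rw [← sqrt_mul (sq_nonneg _)]
  congr 1
  have := EuclideanSpace.norm_sq_eq x
  simp only [Fin.sum_univ_three, norm_eq_abs, sq_abs] at this
  field_simp
  linarith

theorem cos_arccos_norm (x : E3) : cos (arccos (‖x‖⁻¹ * x 2)) = ‖x‖⁻¹ * x 2 := by
  have h : |‖x‖⁻¹ * x 2| ≤ 1 := by
    rw [abs_mul, abs_inv, abs_norm]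
    exact inv_mul_le_one_of_le₀ (PiLp.norm_apply_le x 2) (norm_nonneg _)
  exact cos_arccos (neg_le_of_abs_le h) (le_of_abs_le h)

theorem eval_zero_of_isHomogeneous {n : ℕ} {F : MvPolynomial (Fin 3) ℝ} (hF : F.IsHomogeneous n)
    (hn : n ≠ 0) : eval (0 : E3).ofLp F = 0 := by
  have := eval_smul_of_isHomogeneous hF 0 0
  rwa [zero_smul, zero_pow hn, zero_mul] at this

theorem solidY_eq_eval {n l : ℕ} (hl1 : 1 ≤ l) (hl2 : l ≤ 2 * n + 1) (x : E3) :
    solidY n l x = eval x.ofLp (solidHarmonic n l) := by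
  have hcos (j : ℕ) (hj : j ≤ n) (hx : x ≠ 0) : eval x.ofLp (cosHarmonic n j) =
      ‖x‖ ^ n * (harmonicNorm n j * sin (arccos (‖x‖⁻¹ * x 2)) ^ j *
        cos (j * Complex.arg (x 0 + x 1 * Complex.I)) *
        jacobiP (n - j) j j (cos (arccos (‖x‖⁻¹ * x 2)))) := by
    rw [cosHarmonic, map_mul, map_mul, eval_C, (eval_azimuthal_eq_arg x j).1,
      ← norm_mul_sin_arccos, eval_zonal _ _ hx, eval_gegenbauer, cos_arccos_norm, mul_pow]
    have hn : ‖x‖ ^ n = ‖x‖ ^ (n - j) * ‖x‖ ^ j := by rw [← pow_add, Nat.sub_add_cancel hj]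
    rw [hn]
    ring
  have hsin (j : ℕ) (hj : j ≤ n) (hx : x ≠ 0) : eval x.ofLp (sinHarmonic n j) =
      ‖x‖ ^ n * (harmonicNorm n j * sin (arccos (‖x‖⁻¹ * x 2)) ^ j *
        sin (j * Complex.arg (x 0 + x 1 * Complex.I)) *
        jacobiP (n - j) j j (cos (arccos (‖x‖⁻¹ * x 2)))) := by
    rw [sinHarmonic, map_mul, map_mul, eval_C, (eval_azimuthal_eq_arg x j).2,
      ← norm_mul_sin_arccos, eval_zonal _ _ hx, eval_gegenbauer, cos_arccos_norm, mul_pow]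
    have hn : ‖x‖ ^ n = ‖x‖ ^ (n - j) * ‖x‖ ^ j := by rw [← pow_add, Nat.sub_add_cancel hj]
    rw [hn]
    ring
  rcases eq_or_ne x 0 with rfl | hx
  · rcases eq_or_ne n 0 with rfl | hn
    · obtain rfl : l = 1 := by omega
      have hd := Polynomial.eq_C_of_natDegree_le_zero (natDegree_gegenbauer_le 0 0)
      have hJ (t : ℝ) : jacobiP 0 0 0 t = (gegenbauer 0 0).coeff 0 := by
        have := eval_gegenbauer 0 0 t
        rw [hd, Polynomial.eval_C, Nat.cast_zero] at this
        exact this.symm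
      simp [solidY, sphY, solidHarmonic, cosHarmonic, harmonicNorm, azimuthal, zonal, hJ]
    · rw [eval_zero_of_isHomogeneous (solidHarmonic_spec hl2).1 hn, solidY, norm_zero,
        zero_pow hn, zero_mul]
  · unfold solidY sphY solidHarmonic
    split_ifs with h1 h2
    · rw [hcos 0 n.zero_le hx]
      simp [harmonicNorm]
    · rw [hcos (l / 2) (by omega) hx, harmonicNorm, if_neg (by omega)]
    · rw [hsin (l / 2) (by omega) hx, harmonicNorm, if_neg (by omega)]

end SolidHarmonicBasis

section Radial
open Polynomial

/-- The functional `p ↦ ∫₀¹ p(s) s ^ (c - 1) ds` on polynomials. -/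
noncomputable def momentₗ (c : ℝ) : ℝ[X] →ₗ[ℝ] ℝ :=
  Polynomial.lsum fun i => (1 / ((i : ℝ) + c)) • LinearMap.id

theorem momentₗ_monomial (c : ℝ) (i : ℕ) (a : ℝ) :
    momentₗ c (monomial i a) = 1 / ((i : ℝ) + c) * a := by
  simp [momentₗ, lsum_apply, sum_monomial_index]

theorem momentₗ_X_mul (c : ℝ) (p : ℝ[X]) : momentₗ c (X * p) = momentₗ (c + 1) p := by
  induction p using Polynomial.induction_on' with
  | add p q hp hq => rw [mul_add, map_add, map_add, hp, hq]
  | monomial i a =>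
    rw [X_mul_monomial, momentₗ_monomial, momentₗ_monomial]
    push_cast
    ring_nf

theorem momentₗ_euler {c : ℝ} (hc : 0 < c) (p : ℝ[X]) :
    momentₗ c (X * derivative p) + c * momentₗ c p = p.eval 1 := by
  induction p using Polynomial.induction_on' with
  | add p q hp hq =>
    rw [derivative_add, mul_add, map_add, map_add, eval_add, ← hp, ← hq]; ring
  | monomial i a =>
    have hi : (i : ℝ) + c ≠ 0 := by positivity
    have e : X * derivative (monomial i a) = monomial i (a * i) := by
      rcases i with _ | i
      · simp
      · rw [derivative_monomial, X_mul_monomial, Nat.add_sub_cancel]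
    rw [e, momentₗ_monomial, momentₗ_monomial, eval_monomial]
    field_simp
    simp

/-- The difference `P_{k+1}^{0,β} - P_k^{0,β}` as a polynomial in `s`, where `t = 2 s - 1`. -/
noncomputable def radialPoly (k : ℕ) (β : ℝ) : ℝ[X] :=
  (jacobiPoly (k + 1) 0 β - jacobiPoly k 0 β).comp (X - 1)

theorem eval_radialPoly (k : ℕ) (β s : ℝ) :
    (radialPoly k β).eval s = jacobiP (k + 1) 0 β (2 * s - 1) - jacobiP k 0 β (2 * s - 1) := by
  rw [jacobiP_eq_eval, jacobiP_eq_eval, radialPoly, eval_comp, eval_sub,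
    show (2 * s - 1 - 1) / 2 = s - 1 by ring]
  simp

theorem eval_one_radialPoly (k : ℕ) {β : ℝ} (hβ : 0 ≤ β) : (radialPoly k β).eval 1 = 0 := by
  have h (m : ℕ) : (jacobiPoly m 0 β).eval 0 = 1 := by
    rw [← coeff_zero_eq_eval_zero, coeff_zero_jacobiPoly m hβ]
  simp [radialPoly, h]

theorem derivative_radialPoly (k : ℕ) {β : ℝ} (hβ : 0 ≤ β) :
    derivative (radialPoly k β) = C (2 * k + β + 2) * (jacobiPoly k 0 (β + 1)).comp (X - 1) := by
  rw [radialPoly, derivative_comp, derivative_jacobiPoly_sub k hβ, mul_comp, C_comp]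
  simp

theorem moment_derivative_radialPoly (k k' : ℕ) {β : ℝ} (hβ : 0 ≤ β) :
    momentₗ (β + 2) (derivative (radialPoly k β) * derivative (radialPoly k' β)) =
      if k = k' then 2 * k + β + 2 else 0 := by
  set L : ℝ[X] →ₗ[ℝ] ℝ := momentₗ (β + 2) ∘ₗ (aeval (X - 1 : ℝ[X])).toLinearMap with hLdef
  have hL (g : ℝ[X]) : L ((1 + X) * derivative g + C (β + 1 + 1) * g) = g.coeff 0 := by
    have e : aeval (X - 1 : ℝ[X]) ((1 + X) * derivative g + C (β + 1 + 1) * g) =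
        X * derivative (g.comp (X - 1)) + (β + 2) • g.comp (X - 1) := by
      rw [← comp_eq_aeval, derivative_comp, add_comp, mul_comp, mul_comp, C_comp, add_comp,
        one_comp, X_comp, ← C_mul', show β + 1 + 1 = β + 2 by ring]
      simp
    rw [hLdef, LinearMap.comp_apply, AlgHom.toLinearMap_apply, e, map_add, map_smul, smul_eq_mul,
      momentₗ_euler (by positivity), eval_comp, coeff_zero_eq_eval_zero]
    simp
  have key : momentₗ (β + 2) (derivative (radialPoly k β) * derivative (radialPoly k' β)) =
      (2 * k + β + 2) * (2 * k' + β + 2) *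
        L (jacobiPoly k 0 (β + 1) * jacobiPoly k' 0 (β + 1)) := by
    rw [derivative_radialPoly k hβ, derivative_radialPoly k' hβ, mul_mul_mul_comm, ← C_mul,
      C_mul', map_smul, smul_eq_mul, ← mul_comp, comp_eq_aeval]
    rfl
  rw [key]
  split_ifs with h
  · subst h
    rw [jacobi_functional_mul_self L (by positivity) hL]
    have : 2 * (k : ℝ) + (β + 1) + 1 ≠ 0 := by positivity
    field_simp
    ring
  · rw [jacobi_functional_mul_of_ne L (by positivity) hL h, mul_zero]

end Radial

section BallIntegral
open MvPolynomial

theorem integrableOn_closedBall_eval (F : MvPolynomial (Fin 3) ℝ) :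
    IntegrableOn (fun x : E3 => eval x.ofLp F) (Metric.closedBall 0 1) :=
  (continuous_eval_ofLp F).continuousOn.integrableOn_compact (isCompact_closedBall 0 1)

/-- The integral of a polynomial over the unit ball, as a linear map. -/
noncomputable def ballIntₗ : MvPolynomial (Fin 3) ℝ →ₗ[ℝ] ℝ where
  toFun F := ∫ x in Metric.closedBall (0 : E3) 1, eval x.ofLp F
  map_add' F G := by
    simp only [map_add]
    exact integral_add (integrableOn_closedBall_eval F) (integrableOn_closedBall_eval G)
  map_smul' c F := by
    simp only [smul_eval]
    exact integral_const_mul _ _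

theorem ballIntₗ_apply (F : MvPolynomial (Fin 3) ℝ) :
    ballIntₗ F = ∫ x in Metric.closedBall (0 : E3) 1, eval x.ofLp F := rfl

theorem ballIntₗ_aeval_mul (q : Polynomial ℝ) {d : ℕ} {F : MvPolynomial (Fin 3) ℝ}
    (hF : F.IsHomogeneous d) :
    ballIntₗ (Polynomial.aeval normSqPoly q * F) =
      1 / 2 * momentₗ ((d + 3) / 2) q * sphereInt F := by
  induction q using Polynomial.induction_on' with
  | add p q hp hq => rw [map_add, add_mul, map_add, hp, hq, map_add]; ring
  | monomial i a =>
    have h := integral_closedBall_normSq_pow_mul_eval i hF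
    have e : Polynomial.aeval normSqPoly (Polynomial.monomial i a) * F =
        a • (normSqPoly ^ i * F) := by
      rw [Polynomial.aeval_monomial, algebraMap_eq, mul_assoc, C_mul']
    rw [e, map_smul, ballIntₗ_apply, momentₗ_monomial]
    simp only [map_mul, map_pow, eval_normSqPoly, h, smul_eq_mul]
    have : (i : ℝ) + (d + 3) / 2 ≠ 0 := by positivity
    field_simp
    ring

theorem gradDot_mul_right (F G K : MvPolynomial (Fin 3) ℝ) :
    gradDot K (F * G) = F * gradDot K G + G * gradDot K F := by
  rw [gradDot_comm, gradDot_mul_left, gradDot_comm G, gradDot_comm F]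

theorem gradDot_radial_mul {n n' : ℕ} {H H' : MvPolynomial (Fin 3) ℝ} (hH : H.IsHomogeneous n)
    (hH' : H'.IsHomogeneous n') (q p : Polynomial ℝ) :
    gradDot (Polynomial.aeval normSqPoly q * H) (Polynomial.aeval normSqPoly p * H') =
      Polynomial.aeval normSqPoly
        ((4 : ℝ) • (Polynomial.X * (Polynomial.derivative q * Polynomial.derivative p)) +
          (2 * n' : ℝ) • (Polynomial.derivative q * p) +
          (2 * n : ℝ) • (q * Polynomial.derivative p)) * (H * H') +
      Polynomial.aeval normSqPoly (q * p) * gradDot H H' := by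
  have h1 := gradDot_normSqPoly_of_isHomogeneous hH
  have h2 := gradDot_normSqPoly_of_isHomogeneous hH'
  have h3 := gradDot_normSqPoly_of_isHomogeneous isHomogeneous_normSqPoly
  have h4 : gradDot H (Polynomial.aeval normSqPoly p) =
      Polynomial.aeval normSqPoly (Polynomial.derivative p) * (C (2 * n : ℝ) * H) := by
    rw [gradDot_comm, gradDot_aeval_normSqPoly, h1]
  have h5 : gradDot normSqPoly (Polynomial.aeval normSqPoly p) =
      Polynomial.aeval normSqPoly (Polynomial.derivative p) *
        (C (2 * (2 : ℕ) : ℝ) * normSqPoly) := by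
    rw [gradDot_comm, gradDot_aeval_normSqPoly, h3]
  have e4 : (C (2 * (2 : ℕ) : ℝ) : MvPolynomial (Fin 3) ℝ) = C 4 := by norm_num
  simp only [gradDot_mul_left, gradDot_mul_right, gradDot_aeval_normSqPoly, h2, h4, h5, e4,
    map_add, map_smul, map_mul, Polynomial.aeval_X, smul_eq_C_mul]
  ring

theorem ballIntₗ_gradDot {n : ℕ} {H H' : MvPolynomial (Fin 3) ℝ} (hH : H.IsHomogeneous n)
    (hH' : H'.IsHomogeneous n) (hlap : polyLaplacian H' = 0) (q p : Polynomial ℝ)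
    (hqp : (q * p).eval 1 = 0) :
    ballIntₗ (gradDot (Polynomial.aeval normSqPoly q * H) (Polynomial.aeval normSqPoly p * H')) =
      2 * momentₗ (n + 1 / 2 + 2) (Polynomial.derivative q * Polynomial.derivative p) *
        sphereInt (H * H') := by
  have hg : (gradDot H H').IsHomogeneous (n - 1 + (n - 1)) :=
    IsHomogeneous.sum _ _ _ fun i _ => hH.pderiv.mul hH'.pderiv
  have e : (4 : ℝ) • (Polynomial.X * (Polynomial.derivative q * Polynomial.derivative p)) +
          (2 * n : ℝ) • (Polynomial.derivative q * p) +
          (2 * n : ℝ) • (q * Polynomial.derivative p) =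
      (4 : ℝ) • (Polynomial.X * (Polynomial.derivative q * Polynomial.derivative p)) +
        (2 * n : ℝ) • Polynomial.derivative (q * p) := by
    rw [Polynomial.derivative_mul, smul_add, add_assoc]
  have hE := momentₗ_euler (c := n + 1 / 2) (by positivity) (q * p)
  rw [momentₗ_X_mul, hqp] at hE
  have hc : (((n + n : ℕ) : ℝ) + 3) / 2 = n + 1 / 2 + 1 := by push_cast; ring
  rw [gradDot_radial_mul hH hH', map_add, ballIntₗ_aeval_mul _ (hH.mul hH'),
    ballIntₗ_aeval_mul _ hg, sphereInt_gradDot hH hH' hlap, e, map_add, map_smul, map_smul, hc,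
    momentₗ_X_mul, show (n : ℝ) + 1 / 2 + 1 + 1 = n + 1 / 2 + 2 by ring, smul_eq_mul, smul_eq_mul]
  rcases n with _ | n
  · simp
    ring_nf
    simp
  · have hc' : (((n + 1 - 1 + (n + 1 - 1) : ℕ) : ℝ) + 3) / 2 = (n + 1 : ℕ) + 1 / 2 := by
      push_cast [Nat.add_sub_cancel]; ring
    rw [hc']
    push_cast at hE ⊢
    linear_combination ((n + 1 : ℝ) * sphereInt (H * H')) * hE

theorem ballIntₗ_gradDot_of_ne {n n' : ℕ} {H H' : MvPolynomial (Fin 3) ℝ} (hH : H.IsHomogeneous n)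
    (hH' : H'.IsHomogeneous n') (hlap : polyLaplacian H = 0) (hlap' : polyLaplacian H' = 0)
    (hn : n ≠ n') (q p : Polynomial ℝ) :
    ballIntₗ (gradDot (Polynomial.aeval normSqPoly q * H) (Polynomial.aeval normSqPoly p * H')) =
      0 := by
  have hg : (gradDot H H').IsHomogeneous (n - 1 + (n' - 1)) :=
    IsHomogeneous.sum _ _ _ fun i _ => hH.pderiv.mul hH'.pderiv
  have h0 := sphereInt_mul_of_ne hH hH' hlap hlap' hn
  rw [gradDot_radial_mul hH hH', map_add, ballIntₗ_aeval_mul _ (hH.mul hH'),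
    ballIntₗ_aeval_mul _ hg, sphereInt_gradDot hH hH' hlap', h0]
  simp

theorem ballB_zero (k n l : ℕ) (x : E3) :
    ballB 0 k n l x = jacobiP k 0 ((n : ℝ) + 1 / 2) (2 * ‖x‖ ^ 2 - 1) * solidY n l x := by
  have h : poch ((n : ℝ) + k + 3 / 2) k ≠ 0 :=
    (div_pos (Real.Gamma_pos_of_pos (by positivity)) (Real.Gamma_pos_of_pos (by positivity))).ne'
  rw [ballB, add_zero, div_self h, one_mul]

theorem genBallB_succ_eq_eval {n l : ℕ} (k : ℕ) (hl1 : 1 ≤ l) (hl2 : l ≤ 2 * n + 1) :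
    genBallB (k + 1) n l = fun x => eval x.ofLp
      (Polynomial.aeval normSqPoly (radialPoly k (n + 1 / 2)) * solidHarmonic n l) := by
  funext x
  have h (q : Polynomial ℝ) : eval x.ofLp (Polynomial.aeval normSqPoly q) = q.eval (‖x‖ ^ 2) := by
    induction q using Polynomial.induction_on' with
    | add p q hp hq => rw [map_add, map_add, hp, hq, Polynomial.eval_add]
    | monomial n a => simp [Polynomial.aeval_monomial, eval_normSqPoly]
  rw [genBallB, if_neg k.succ_ne_zero, Nat.add_sub_cancel, ballB_zero, ballB_zero, map_mul, h,
    eval_radialPoly, solidY_eq_eval hl1 hl2]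
  ring

theorem inner_gradient_eval (F G : MvPolynomial (Fin 3) ℝ) (x : E3) :
    ⟪gradient (fun y : E3 => eval y.ofLp F) x, gradient (fun y : E3 => eval y.ofLp G) x⟫ =
      eval x.ofLp (gradDot F G) := by
  rw [(hasGradientAt_eval F x).gradient, (hasGradientAt_eval G x).gradient]
  simp [gradDot, PiLp.inner_apply, mul_comm]

end BallIntegral

/-- gradient orthogonality of the generalized ball polynomials:
`∫_{B³} ∇B_{k,l}^{-1,n} · ∇B_{k',l'}^{-1,n'} dx = (2n+4k+1) δ_{kk'} δ_{nn'} δ_{ll'}`,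
so the stiffness matrix of the spectral-Galerkin scheme is strictly diagonal. -/
theorem generalized_ball_gradient_orthogonal (k k' n n' l l' : ℕ)
    (hk : 1 ≤ k) (hk' : 1 ≤ k')
    (hl1 : 1 ≤ l) (hl2 : l ≤ 2 * n + 1) (hl1' : 1 ≤ l') (hl2' : l' ≤ 2 * n' + 1) :
    (∫ x in Metric.closedBall (0 : E3) 1,
        ⟪gradient (genBallB k n l) x, gradient (genBallB k' n' l') x⟫) =
      if k = k' ∧ n = n' ∧ l = l' then 2 * (n : ℝ) + 4 * k + 1 else 0 := by
  obtain ⟨k, rfl⟩ := Nat.exists_eq_add_of_le' hk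
  obtain ⟨k', rfl⟩ := Nat.exists_eq_add_of_le' hk'
  simp only [genBallB_succ_eq_eval k hl1 hl2, genBallB_succ_eq_eval k' hl1' hl2',
    inner_gradient_eval]
  rw [← ballIntₗ_apply]
  obtain ⟨hH, hlap⟩ := solidHarmonic_spec hl2
  obtain ⟨hH', hlap'⟩ := solidHarmonic_spec hl2'
  by_cases hn : n = n'
  · subst hn
    have hβ : (0 : ℝ) ≤ n + 1 / 2 := by positivity
    rw [ballIntₗ_gradDot hH hH' hlap' _ _
      (by rw [Polynomial.eval_mul, eval_one_radialPoly k hβ, zero_mul]),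
      moment_derivative_radialPoly k k' hβ]
    by_cases hkk : k = k'
    · subst hkk
      by_cases hll : l = l'
      · subst hll
        simp only [and_self, if_true]
        rw [sphereInt_solidHarmonic_mul_self hl1 hl2]
        push_cast
        ring
      · rw [sphereInt_solidHarmonic_mul_of_ne n hl1 hl1' hll]
        simp [hll]
    · simp [hkk]
  · rw [ballIntₗ_gradDot_of_ne hH hH' hlap hlap' hn]
    simp [hn]
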